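/- arXiv:1107.3341 — 2 statements merged into one kernel-verified Lean document; each statement's English description precedes it below -/
import Mathlib

section
/- Let w1, w2 be words. Suppose there exist finite groups I_k and J_k for k = 1, 2 and integers d, e ≥ 5 with the following properties: (a) for k = 1, 2, w_k(I_k) contains an element of order d; (b) for k = 1, 2, w_k(J_k) contains an element of order e; (c) |I_1|·|I_2| and |J_1|·|J_2| are relatively prime; (d) d is even. Then for all n sufficiently large, every finite quasisimple group G with G/Z(G) isomorphic to the alternating group A_n satisfies w1(G)·w2(G) = G. -/
/-- The set of values of the word `w` in the group `G`: the image of the word map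
`G^d → G` induced by substitution. -/
def wordImage {d : ℕ} (w : FreeGroup (Fin d)) (G : Type*) [Group G] : Set G :=
  Set.range fun f : Fin d → G => FreeGroup.lift f w

/-- A group is quasisimple if it is perfect and its quotient by its center is a
non-abelian simple group. -/
def IsQuasisimple (G : Type*) [Group G] : Prop :=
  commutator G = ⊤ ∧ IsSimpleGroup (G ⧸ Subgroup.center G) ∧
    ∃ a b : G ⧸ Subgroup.center G, a * b ≠ b * a

section CycleProducts

variable {Ω : Type*} [DecidableEq Ω]

/-- The product of the cycles written in the given lists. -/
def cycleProd (ls : List (List Ω)) : Equiv.Perm Ω := (ls.map List.formPerm).prod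

theorem cycleProd_nil : cycleProd ([] : List (List Ω)) = 1 := rfl

theorem cycleProd_cons (l : List Ω) (ls : List (List Ω)) :
    cycleProd (l :: ls) = l.formPerm * cycleProd ls := by
  simp [cycleProd]

theorem cycleProd_append (ls ms : List (List Ω)) :
    cycleProd (ls ++ ms) = cycleProd ls * cycleProd ms := by
  simp [cycleProd]

theorem cycleProd_apply_of_notMem {ls : List (List Ω)} {x : Ω} (h : x ∉ ls.flatten) :
    cycleProd ls x = x := by
  induction ls with
  | nil => rfl
  | cons l ls ih =>
    rw [List.flatten_cons, List.mem_append, not_or] at h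
    rw [cycleProd_cons, Equiv.Perm.mul_apply, ih h.2, List.formPerm_apply_of_notMem h.1]

theorem cycleProd_disjoint {ls ms : List (List Ω)}
    (h : ∀ x ∈ ls.flatten, x ∉ ms.flatten) :
    Equiv.Perm.Disjoint (cycleProd ls) (cycleProd ms) := by
  intro x
  by_cases hx : x ∈ ls.flatten
  · exact Or.inr (cycleProd_apply_of_notMem (h x hx))
  · exact Or.inl (cycleProd_apply_of_notMem hx)

theorem formPerm_eq_cycleProd (l : List Ω) : l.formPerm = cycleProd [l] := by
  simp [cycleProd]

theorem cycleProd_perm {ls ms : List (List Ω)} (h : ls.Perm ms) (hn : ls.flatten.Nodup) :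
    cycleProd ls = cycleProd ms := by
  refine (h.map List.formPerm).prod_eq' ?_
  rw [List.pairwise_map]
  refine (List.nodup_flatten.1 hn).2.imp ?_
  intro a b hab
  rw [formPerm_eq_cycleProd, formPerm_eq_cycleProd]
  refine (cycleProd_disjoint ?_).commute
  simpa using fun x hx hx' => hab hx hx'

theorem cycleProd_apply_of_mem {ls : List (List Ω)} (hn : ls.flatten.Nodup) {l : List Ω}
    (hl : l ∈ ls) {x : Ω} (hx : x ∈ l) : cycleProd ls x = l.formPerm x := by
  obtain ⟨s, t, rfl⟩ := List.append_of_mem hl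
  rw [cycleProd_perm List.perm_middle hn, cycleProd_cons, Equiv.Perm.mul_apply,
    cycleProd_apply_of_notMem]
  intro hx'
  have hn' := (List.perm_middle (a := l) (l₁ := s) (l₂ := t)).flatten.nodup_iff.1 hn
  rw [List.flatten_cons, List.nodup_append] at hn'
  exact hn'.2.2 x hx x hx' rfl

theorem cycleType_formPerm_of_nodup [Fintype Ω] {l : List Ω} (hn : l.Nodup)
    (hl : 2 ≤ l.length) : l.formPerm.cycleType = {l.length} := by
  rw [(List.isCycle_formPerm hn hl).cycleType, List.support_formPerm_of_nodup l hn,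
    List.toFinset_card_of_nodup hn]
  rintro x rfl
  simp at hl

theorem cycleProd_cycleType [Fintype Ω] {ls : List (List Ω)} (hn : ls.flatten.Nodup) {d : ℕ}
    (hd : 2 ≤ d) (hl : ∀ l ∈ ls, l.length = d) :
    (cycleProd ls).cycleType = Multiset.replicate ls.length d := by
  induction ls with
  | nil => simp [cycleProd_nil]
  | cons l ls ih =>
    rw [List.flatten_cons, List.nodup_append] at hn
    have hdis : Equiv.Perm.Disjoint l.formPerm (cycleProd ls) := by
      rw [formPerm_eq_cycleProd]
      refine cycleProd_disjoint fun x hx hx' => ?_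
      exact hn.2.2 x (by simpa using hx) x hx' rfl
    have hll := hl l (by simp)
    rw [cycleProd_cons, hdis.cycleType_mul, ih hn.2.1 (fun m hm => hl m (by simp [hm])),
      cycleType_formPerm_of_nodup hn.1 (by omega), hll, List.length_cons, Multiset.replicate_succ]
    rfl

theorem formPerm_append_cons (u m : List Ω) (a : Ω) :
    (u ++ a :: m).formPerm = (u ++ [a]).formPerm * (a :: m).formPerm := by
  induction u with
  | nil => simp
  | cons b u ih =>
    cases u with
    | nil => simp
    | cons c u =>
      simp only [List.cons_append, List.formPerm_cons_cons] at ih ⊢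
      rw [ih, mul_assoc]

theorem formPerm_cons_append_singleton (v : List Ω) {x y : Ω} (h : x ∉ v ++ [y]) :
    (x :: (v ++ [y])).formPerm = (v ++ [y]).formPerm * Equiv.swap x y := by
  cases v with
  | nil => simp
  | cons a v =>
    have h1 : ((a :: v) ++ [y]).formPerm y = a := by simp
    have h2 := List.formPerm_apply_of_notMem h
    rw [Equiv.mul_swap_eq_swap_mul, h1, h2]
    simp

theorem formPerm_append_append (u v : List Ω) {x y : Ω} (h : x ∉ v ++ [y]) :
    (u ++ [x] ++ v ++ [y]).formPerm =
      (u ++ [x]).formPerm * (v ++ [y]).formPerm * Equiv.swap x y := by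
  rw [mul_assoc, ← formPerm_cons_append_singleton v h, ← formPerm_append_cons]
  simp

end CycleProducts

section Slots

/-- A pair of cycles, written as lists, sharing the last point `base`. -/
structure Slot (Ω : Type*) where
  /-- the first cycle without its last point -/
  left : List Ω
  /-- the second cycle without its last point -/
  right : List Ω
  /-- the last point of both cycles -/
  base : Ω

namespace Slot

variable {Ω : Type*}

/-- The first cycle of a slot. -/
def leftCycle (e : Slot Ω) : List Ω := e.left ++ [e.base]

/-- The second cycle of a slot. -/
def rightCycle (e : Slot Ω) : List Ω := e.right ++ [e.base]

/-- The lengths of the two cycles of a slot. -/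
def lengths (e : Slot Ω) : ℕ × ℕ := (e.left.length + 1, e.right.length + 1)

/-- The slot with the two cycles exchanged. -/
def flip (e : Slot Ω) : Slot Ω := ⟨e.right, e.left, e.base⟩

/-- The points of all first cycles. -/
def leftPoints (es : List (Slot Ω)) : List Ω := (es.map leftCycle).flatten

/-- The points of all second cycles. -/
def rightPoints (es : List (Slot Ω)) : List Ω := (es.map rightCycle).flatten

theorem leftPoints_nil : leftPoints ([] : List (Slot Ω)) = [] := rfl

theorem rightPoints_nil : rightPoints ([] : List (Slot Ω)) = [] := rfl

theorem leftPoints_cons (e : Slot Ω) (es : List (Slot Ω)) :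
    leftPoints (e :: es) = e.left ++ e.base :: leftPoints es := by
  simp [leftPoints, leftCycle]

theorem rightPoints_cons (e : Slot Ω) (es : List (Slot Ω)) :
    rightPoints (e :: es) = e.right ++ e.base :: rightPoints es := by
  simp [rightPoints, rightCycle]

theorem leftPoints_append (es fs : List (Slot Ω)) :
    leftPoints (es ++ fs) = leftPoints es ++ leftPoints fs := by
  simp [leftPoints]

theorem rightPoints_append (es fs : List (Slot Ω)) :
    rightPoints (es ++ fs) = rightPoints es ++ rightPoints fs := by
  simp [rightPoints]

theorem leftPoints_perm {es fs : List (Slot Ω)} (h : es.Perm fs) :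
    (leftPoints es).Perm (leftPoints fs) := (h.map _).flatten

theorem rightPoints_perm {es fs : List (Slot Ω)} (h : es.Perm fs) :
    (rightPoints es).Perm (rightPoints fs) := (h.map _).flatten

theorem leftPoints_flip (es : List (Slot Ω)) :
    leftPoints (es.map flip) = rightPoints es := by
  simp only [leftPoints, rightPoints, List.map_map]
  rfl

theorem rightPoints_flip (es : List (Slot Ω)) :
    rightPoints (es.map flip) = leftPoints es := by
  simp only [leftPoints, rightPoints, List.map_map]
  rfl

/-- The first cycles are disjoint, the second cycles are disjoint, and all cycles lie in `l`. -/
structure Valid (es : List (Slot Ω)) (l : List Ω) : Prop where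
  left_nodup : (leftPoints es).Nodup
  right_nodup : (rightPoints es).Nodup
  left_subset : leftPoints es ⊆ l
  right_subset : rightPoints es ⊆ l

theorem Valid.mono {es : List (Slot Ω)} {l m : List Ω} (h : Valid es l) (hlm : l ⊆ m) :
    Valid es m :=
  ⟨h.1, h.2, fun _ hx => hlm (h.3 hx), fun _ hx => hlm (h.4 hx)⟩

theorem Valid.perm {es fs : List (Slot Ω)} {l : List Ω} (h : Valid es l) (hp : es.Perm fs) :
    Valid fs l :=
  ⟨(leftPoints_perm hp).nodup_iff.1 h.1, (rightPoints_perm hp).nodup_iff.1 h.2,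
    fun _ hx => h.3 ((leftPoints_perm hp).mem_iff.2 hx),
    fun _ hx => h.4 ((rightPoints_perm hp).mem_iff.2 hx)⟩

theorem Valid.flip {es : List (Slot Ω)} {l : List Ω} (h : Valid es l) :
    Valid (es.map Slot.flip) l :=
  ⟨by simpa [leftPoints_flip] using h.2, by simpa [rightPoints_flip] using h.1,
    by simpa [leftPoints_flip] using h.4, by simpa [rightPoints_flip] using h.3⟩

theorem valid_nil (l : List Ω) : Valid ([] : List (Slot Ω)) l :=
  ⟨by simp [leftPoints], by simp [rightPoints], by simp [leftPoints], by simp [rightPoints]⟩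

/-- The slot obtained by fusing two slots. -/
def merge (e f : Slot Ω) : Slot Ω :=
  ⟨e.left ++ [e.base] ++ f.left, e.right ++ [e.base] ++ f.right, f.base⟩

theorem lengths_merge (e f : Slot Ω) : (merge e f).lengths = e.lengths + f.lengths := by
  simp [merge, lengths]; omega

theorem leftPoints_merge (es : List (Slot Ω)) (e f : Slot Ω) :
    leftPoints (es ++ [merge e f]) = leftPoints (es ++ [e, f]) := by
  simp [leftPoints, merge, leftCycle]

theorem rightPoints_merge (es : List (Slot Ω)) (e f : Slot Ω) :
    rightPoints (es ++ [merge e f]) = rightPoints (es ++ [e, f]) := by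
  simp [rightPoints, merge, rightCycle]

theorem Valid.merge {es : List (Slot Ω)} {e f : Slot Ω} {l : List Ω}
    (h : Valid (es ++ [e, f]) l) : Valid (es ++ [Slot.merge e f]) l :=
  ⟨by rw [leftPoints_merge]; exact h.1, by rw [rightPoints_merge]; exact h.2,
   by rw [leftPoints_merge]; exact h.3, by rw [rightPoints_merge]; exact h.4⟩

variable [DecidableEq Ω]

/-- The product of the first cycles times the inverse of the product of the second cycles. -/
def value (es : List (Slot Ω)) : Equiv.Perm Ω :=
  cycleProd (es.map leftCycle) * (cycleProd (es.map rightCycle))⁻¹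

theorem value_nil : value ([] : List (Slot Ω)) = 1 := by
  simp [value, cycleProd_nil]

theorem value_singleton (e : Slot Ω) :
    value [e] = (e.left ++ [e.base]).formPerm * (e.right ++ [e.base]).formPerm⁻¹ := by
  simp [value, cycleProd, leftCycle, rightCycle]

theorem value_perm {es fs : List (Slot Ω)} (h : es.Perm fs) (hl : (leftPoints es).Nodup)
    (hr : (rightPoints es).Nodup) : value es = value fs := by
  rw [value, value, cycleProd_perm (h.map _) hl, cycleProd_perm (h.map _) hr]

theorem value_flip (es : List (Slot Ω)) : value (es.map flip) = (value es)⁻¹ := by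
  simp only [value, List.map_map, mul_inv_rev, inv_inv]
  rfl

theorem value_append {es fs : List (Slot Ω)} (hl : ∀ x ∈ rightPoints es, x ∉ leftPoints fs)
    (hr : ∀ x ∈ rightPoints es, x ∉ rightPoints fs) :
    value (es ++ fs) = value es * value fs := by
  have h1 := (cycleProd_disjoint hl).commute
  have h2 := (cycleProd_disjoint hr).commute
  simp only [value, List.map_append, cycleProd_append]
  have h := (h1.inv_left.mul_right h2.inv_right.inv_left).eq
  rw [mul_inv_rev, mul_assoc, ← mul_assoc _ _ (_ : Equiv.Perm Ω)⁻¹, ← h]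
  simp only [mul_assoc]

theorem value_apply_of_notMem {es : List (Slot Ω)} {x : Ω} (hl : x ∉ leftPoints es)
    (hr : x ∉ rightPoints es) : value es x = x := by
  rw [value, Equiv.Perm.mul_apply, Equiv.Perm.inv_eq_iff_eq.2 (cycleProd_apply_of_notMem hr).symm,
    cycleProd_apply_of_notMem hl]

theorem value_merge (es : List (Slot Ω)) (e f : Slot Ω) (hl : (leftPoints (es ++ [e, f])).Nodup)
    (hr : (rightPoints (es ++ [e, f])).Nodup) :
    value (es ++ [merge e f]) = value (es ++ [e, f]) := by
  have hl' : e.base ∉ f.left ++ [f.base] := by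
    simp [leftPoints_append, leftPoints_cons, List.nodup_append] at hl ⊢
    grind
  have hr' : e.base ∉ f.right ++ [f.base] := by
    simp [rightPoints_append, rightPoints_cons, List.nodup_append] at hr ⊢
    grind
  simp only [value, List.map_append, cycleProd_append, List.map_cons, List.map_nil, cycleProd_cons,
    cycleProd_nil, mul_one, leftCycle, rightCycle, merge]
  rw [formPerm_append_append _ _ hl', formPerm_append_append _ _ hr']
  simp [mul_assoc]

end Slot

/-- Every list of `s` distinct points carries slots with the multiset `T` of cycle lengths whose
value has cycle type `c`. -/
def Dec (s : ℕ) (c : Multiset ℕ) (T : Multiset (ℕ × ℕ)) : Prop :=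
  ∀ (Ω : Type) [Fintype Ω] [DecidableEq Ω] (l : List Ω), l.Nodup → l.length = s →
    ∃ es : List (Slot Ω), Slot.Valid es l ∧ (es.map Slot.lengths : Multiset (ℕ × ℕ)) = T ∧
      (Slot.value es).cycleType = c

theorem Dec.add {s s' : ℕ} {c c' : Multiset ℕ} {T T' : Multiset (ℕ × ℕ)} (h : Dec s c T)
    (h' : Dec s' c' T') : Dec (s + s') (c + c') (T + T') := by
  intro Ω _ _ l hl hs
  have hd : (l.take s ++ l.drop s).Nodup := by rwa [List.take_append_drop]
  rw [List.nodup_append] at hd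
  obtain ⟨es, hes, hT, hc⟩ := h Ω (l.take s) hd.1 (by simp; omega)
  obtain ⟨fs, hfs, hT', hc'⟩ := h' Ω (l.drop s) hd.2.1 (by simp; omega)
  have hdis : ∀ x ∈ l.take s, x ∉ l.drop s := fun x hx hx' => hd.2.2 x hx x hx' rfl
  refine ⟨es ++ fs, ⟨?_, ?_, ?_, ?_⟩, ?_, ?_⟩
  · rw [Slot.leftPoints_append, List.nodup_append]
    exact ⟨hes.1, hfs.1, fun a ha b hb hab => hdis a (hes.3 ha) (hab ▸ hfs.3 hb)⟩
  · rw [Slot.rightPoints_append, List.nodup_append]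
    exact ⟨hes.2, hfs.2, fun a ha b hb hab => hdis a (hes.4 ha) (hab ▸ hfs.4 hb)⟩
  · rw [Slot.leftPoints_append]
    exact List.append_subset.2 ⟨fun x hx => List.mem_of_mem_take (hes.3 hx),
      fun x hx => List.mem_of_mem_drop (hfs.3 hx)⟩
  · rw [Slot.rightPoints_append]
    exact List.append_subset.2 ⟨fun x hx => List.mem_of_mem_take (hes.4 hx),
      fun x hx => List.mem_of_mem_drop (hfs.4 hx)⟩
  · rw [← hT, ← hT', List.map_append, Multiset.coe_add]
  · rw [Slot.value_append (fun x hx hx' => hdis x (hes.4 hx) (hfs.3 hx'))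
      (fun x hx hx' => hdis x (hes.4 hx) (hfs.4 hx')), Equiv.Perm.Disjoint.cycleType_mul, hc, hc']
    intro x
    by_cases hx : x ∈ l.take s
    · exact Or.inr (Slot.value_apply_of_notMem (fun hx' => hdis x hx (hfs.3 hx'))
        (fun hx' => hdis x hx (hfs.4 hx')))
    · exact Or.inl (Slot.value_apply_of_notMem (fun hx' => hx (hes.3 hx'))
        (fun hx' => hx (hes.4 hx')))

theorem Dec.flip {s : ℕ} {c : Multiset ℕ} {T : Multiset (ℕ × ℕ)} (h : Dec s c T) :
    Dec s c (T.map Prod.swap) := by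
  intro Ω _ _ l hl hs
  obtain ⟨es, hes, hT, hc⟩ := h Ω l hl hs
  refine ⟨es.map Slot.flip, hes.flip, ?_, ?_⟩
  · rw [← hT]
    simp [Function.comp_def, Slot.lengths, Slot.flip]
  · rw [Slot.value_flip, Equiv.Perm.cycleType_inv, hc]

theorem Dec.merge {s : ℕ} {c : Multiset ℕ} {x y : ℕ × ℕ} {T : Multiset (ℕ × ℕ)}
    (h : Dec s c (x ::ₘ y ::ₘ T)) : Dec s c ((x + y) ::ₘ T) := by
  intro Ω _ _ l hl hs
  obtain ⟨es, hes, hT, hc⟩ := h Ω l hl hs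
  classical
  have hT1 : (es : Multiset (Slot Ω)).map Slot.lengths = x ::ₘ y ::ₘ T := hT
  obtain ⟨e, he, rfl, hT2⟩ := (Multiset.map_eq_cons _ _ _ _).2 hT1
  obtain ⟨f, hf, rfl, hT3⟩ := (Multiset.map_eq_cons _ _ _ _).2 hT2
  obtain ⟨fs, hfs⟩ := Quotient.exists_rep (((es : Multiset (Slot Ω)).erase e).erase f)
  have hp : es.Perm (fs ++ [e, f]) := by
    rw [← Multiset.coe_eq_coe, ← Multiset.coe_add, ← Multiset.cons_erase he,
      ← Multiset.cons_erase hf, ← hfs]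
    exact Multiset.coe_eq_coe.2 (List.perm_append_comm (l₁ := [e, f]))
  have hv := hes.perm hp
  refine ⟨fs ++ [Slot.merge e f], hv.merge, ?_, ?_⟩
  · rw [← hT3, ← hfs, List.map_append, ← Multiset.coe_add, add_comm, ← Slot.lengths_merge]
    rfl
  · rw [Slot.value_merge _ _ _ hv.1 hv.2, ← Slot.value_perm hp hes.1 hes.2, hc]

theorem Dec.mono {s s' : ℕ} {c : Multiset ℕ} {T : Multiset (ℕ × ℕ)} (h : Dec s c T)
    (hs : s ≤ s') : Dec s' c T := by
  intro Ω _ _ l hl hls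
  obtain ⟨es, hes, hT, hc⟩ := h Ω (l.take s) (hl.sublist (List.take_sublist _ _))
    (by simp; omega)
  exact ⟨es, hes.mono (List.take_subset _ _), hT, hc⟩

theorem dec_zero : Dec 0 0 0 := by
  intro Ω _ _ l _ _
  exact ⟨[], Slot.valid_nil l, rfl, by simp [Slot.value_nil]⟩

theorem dec_one : Dec 1 0 {(1, 1)} := by
  intro Ω _ _ l _ hl
  obtain ⟨x, rfl⟩ := List.length_eq_one_iff.1 hl
  refine ⟨[⟨[], [], x⟩], ⟨?_, ?_, ?_, ?_⟩, ?_, ?_⟩ <;>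
    simp [Slot.leftPoints_cons, Slot.rightPoints_cons, Slot.leftPoints_nil, Slot.rightPoints_nil,
      Slot.lengths, Slot.value_singleton]

end Slots

section Chains

variable {Ω : Type*} [DecidableEq Ω]

/-- Slots on the points of `l` whose value is the cycle written in `l` and whose first cycles avoid
the head of `l`. -/
def HasChain (l : List Ω) (T : Multiset (ℕ × ℕ)) : Prop :=
  ∃ es : List (Slot Ω), Slot.Valid es l ∧ (∀ x ∈ l.head?, x ∉ Slot.leftPoints es) ∧
    (es.map Slot.lengths : Multiset (ℕ × ℕ)) = T ∧ Slot.value es = l.formPerm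

theorem hasChain_singleton (x : Ω) : HasChain [x] 0 :=
  ⟨[], Slot.valid_nil _, by simp [Slot.leftPoints_nil], rfl, by simp [Slot.value_nil]⟩

theorem hasChain_pair {x b : Ω} (h : x ≠ b) : HasChain [x, b] {(1, 2)} := by
  refine ⟨[⟨[], [x], b⟩], ⟨?_, ?_, ?_, ?_⟩, ?_, ?_, ?_⟩ <;>
    simp [Slot.leftPoints_cons, Slot.rightPoints_cons, Slot.leftPoints_nil, Slot.rightPoints_nil,
      Slot.lengths, Slot.value_singleton, h]

theorem HasChain.extend_two {x a b : Ω} {m : List Ω} {T : Multiset (ℕ × ℕ)}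
    (h : HasChain (a :: m) T) (hn : (x :: a :: (m ++ [b])).Nodup) :
    HasChain (x :: a :: (m ++ [b])) ((2, 2) ::ₘ T) := by
  obtain ⟨es, hes, hhead, hT, hv⟩ := h
  have ha : a ∉ Slot.leftPoints es := by simpa using hhead
  have hn' := hn
  simp only [List.nodup_cons, List.mem_cons, List.mem_append, List.nodup_append, not_or] at hn'
  obtain ⟨⟨hxa, hxm, hxb, -⟩, ⟨ham, hab, -⟩, hm, -, hmb⟩ := hn'
  have hbm : b ∉ m := fun hb => hmb b hb b (by simp) rfl
  have hL : ∀ z ∈ Slot.leftPoints es, z = a ∨ z ∈ m := fun z hz => by simpa using hes.3 hz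
  have hR : ∀ z ∈ Slot.rightPoints es, z = a ∨ z ∈ m := fun z hz => by simpa using hes.4 hz
  have hxL : x ∉ Slot.leftPoints es := fun hz => by grind
  have hxR : x ∉ Slot.rightPoints es := fun hz => by grind
  have hbL : b ∉ Slot.leftPoints es := fun hz => by grind
  have hbR : b ∉ Slot.rightPoints es := fun hz => by grind
  refine ⟨⟨[a], [x], b⟩ :: es, ⟨?_, ?_, ?_, ?_⟩, ?_, ?_, ?_⟩
  · have := hes.1
    simp [Slot.leftPoints_cons]
    grind
  · have := hes.2
    simp [Slot.rightPoints_cons]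
    grind
  · intro z hz
    simp [Slot.leftPoints_cons] at hz ⊢
    grind
  · intro z hz
    simp [Slot.rightPoints_cons] at hz ⊢
    grind
  · simp [Slot.leftPoints_cons]
    grind
  · simp [Slot.lengths, ← hT]
  · have h1 := Slot.value_append (es := [⟨[a], [x], b⟩]) (fs := es)
      (by simp [Slot.rightPoints_cons, Slot.rightPoints_nil, *])
      (by simp [Slot.rightPoints_cons, Slot.rightPoints_nil, *])
    rw [List.singleton_append] at h1
    have h2 := List.formPerm_rotate (x :: a :: (m ++ [b])) hn (m.length + 2)
    have h3 : (x :: a :: (m ++ [b])).rotate (m.length + 2) = [b, x] ++ a :: m := by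
      simp [List.rotate_append_length_eq]
    rw [h1, hv, ← h2, h3, formPerm_append_cons, Slot.value_singleton]
    congr 1
    have hax := Ne.symm hxa
    ext z
    simp [Equiv.swap_apply_def]
    grind

theorem HasChain.extend_four {x a c b v : Ω} {m : List Ω} {T : Multiset (ℕ × ℕ)}
    (h : HasChain (c :: m) T) (hn : (x :: a :: c :: (m ++ [b, v])).Nodup) :
    HasChain (x :: a :: c :: (m ++ [b, v])) ((3, 3) ::ₘ T) := by
  obtain ⟨es, hes, hhead, hT, hv⟩ := h
  have hc : c ∉ Slot.leftPoints es := by simpa using hhead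
  have hn' := hn
  simp only [List.nodup_cons, List.mem_cons, List.mem_append, List.nodup_append, not_or] at hn'
  obtain ⟨⟨hxa, hxc, hxm, hxb, hxv, -⟩, ⟨hac, ham, hab, hav, -⟩, ⟨hcm, hcb, hcv, -⟩, hm,
    ⟨⟨hbv, -⟩, -⟩, hmb⟩ := hn'
  have hbm : b ∉ m := fun hb => hmb b hb b (by simp) rfl
  have hvm : v ∉ m := fun hb => hmb v hb v (by simp) rfl
  have hL : ∀ z ∈ Slot.leftPoints es, z = c ∨ z ∈ m := fun z hz => by simpa using hes.3 hz
  have hR : ∀ z ∈ Slot.rightPoints es, z = c ∨ z ∈ m := fun z hz => by simpa using hes.4 hz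
  have hxL : x ∉ Slot.leftPoints es := fun hz => by grind
  have hxR : x ∉ Slot.rightPoints es := fun hz => by grind
  have haL : a ∉ Slot.leftPoints es := fun hz => by grind
  have hbL : b ∉ Slot.leftPoints es := fun hz => by grind
  have hbR : b ∉ Slot.rightPoints es := fun hz => by grind
  have hvL : v ∉ Slot.leftPoints es := fun hz => by grind
  have hvR : v ∉ Slot.rightPoints es := fun hz => by grind
  refine ⟨⟨[a, c], [x, v], b⟩ :: es, ⟨?_, ?_, ?_, ?_⟩, ?_, ?_, ?_⟩
  · have := hes.1
    simp [Slot.leftPoints_cons]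
    grind
  · have := hes.2
    simp [Slot.rightPoints_cons]
    grind
  · intro z hz
    simp [Slot.leftPoints_cons] at hz ⊢
    grind
  · intro z hz
    simp [Slot.rightPoints_cons] at hz ⊢
    grind
  · simp [Slot.leftPoints_cons]
    grind
  · simp [Slot.lengths, ← hT]
  · have h1 := Slot.value_append (es := [⟨[a, c], [x, v], b⟩]) (fs := es)
      (by simp [Slot.rightPoints_cons, Slot.rightPoints_nil, *])
      (by simp [Slot.rightPoints_cons, Slot.rightPoints_nil, *])
    rw [List.singleton_append] at h1
    have h2 := List.formPerm_rotate (x :: a :: c :: (m ++ [b, v])) hn (m.length + 3)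
    have h3 : (x :: a :: c :: (m ++ [b, v])).rotate (m.length + 3) = [b, v, x, a] ++ c :: m := by
      simp [List.rotate_append_length_eq]
    rw [h1, hv, ← h2, h3, formPerm_append_cons, Slot.value_singleton]
    congr 1
    rw [mul_inv_eq_iff_eq_mul]
    ext z
    simp [Equiv.swap_apply_def]
    grind

theorem exists_cons_append_singleton {α : Type*} {l : List α} {k : ℕ} (h : l.length = k + 3) :
    ∃ x a m b, l = x :: a :: (m ++ [b]) ∧ m.length = k := by
  obtain _ | ⟨x, _ | ⟨a, l⟩⟩ := l
  · simp at h
  · simp at h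
  obtain rfl | ⟨m, b, rfl⟩ := l.eq_nil_or_concat
  · simp at h
  exact ⟨x, a, m, b, by simp, by simpa using h⟩

theorem hasChain_add (t : ℕ) {k : ℕ} {T : Multiset (ℕ × ℕ)}
    (h : ∀ l : List Ω, l.Nodup → l.length = k + 1 → HasChain l T) :
    ∀ l : List Ω, l.Nodup → l.length = 2 * t + k + 1 →
      HasChain l (Multiset.replicate t (2, 2) + T) := by
  induction t with
  | zero => simpa using h
  | succ t ih =>
    intro l hl hlen
    obtain ⟨x, a, m, b, rfl, hm⟩ := exists_cons_append_singleton (k := 2 * t + k)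
      (by rw [hlen]; ring)
    rw [Multiset.replicate_succ, Multiset.cons_add]
    refine (ih (a :: m) ?_ (by simp [hm])).extend_two hl
    simp [List.nodup_append] at hl ⊢
    tauto

theorem hasChain_add_four (j : ℕ) {k : ℕ} {T : Multiset (ℕ × ℕ)}
    (h : ∀ l : List Ω, l.Nodup → l.length = k + 1 → HasChain l T) :
    ∀ l : List Ω, l.Nodup → l.length = 4 * j + k + 1 →
      HasChain l (Multiset.replicate j (3, 3) + T) := by
  induction j with
  | zero => simpa using h
  | succ j ih =>
    intro l hl hlen
    obtain ⟨x, a, m, v, rfl, hm⟩ := exists_cons_append_singleton (k := 4 * j + k + 2)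
      (by rw [hlen]; ring)
    obtain _ | ⟨c, m⟩ := m
    · simp at hm
    obtain rfl | ⟨m, b, rfl⟩ := m.eq_nil_or_concat
    · simp at hm
    have e : x :: a :: (c :: (m.concat b) ++ [v]) = x :: a :: c :: (m ++ [b, v]) := by simp
    rw [e] at hl ⊢
    rw [Multiset.replicate_succ, Multiset.cons_add]
    refine (ih (c :: m) ?_ (by simp at hm ⊢; omega)).extend_four hl
    simp [List.nodup_append] at hl ⊢
    tauto

theorem hasChain_odd (t j : ℕ) (l : List Ω) (hl : l.Nodup) (hlen : l.length = 2 * t + 4 * j + 1) :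
    HasChain l (Multiset.replicate t (2, 2) + Multiset.replicate j (3, 3)) := by
  refine hasChain_add t (k := 4 * j) (fun m hm hml => ?_) l hl hlen
  have := hasChain_add_four j (k := 0) (T := 0) (fun m hm hml => ?_) m hm hml
  · simpa using this
  · obtain ⟨x, rfl⟩ := List.length_eq_one_iff.1 hml
    exact hasChain_singleton x

theorem hasChain_even (t j : ℕ) (l : List Ω) (hl : l.Nodup) (hlen : l.length = 2 * t + 4 * j + 2) :
    HasChain l (Multiset.replicate t (2, 2) + (Multiset.replicate j (3, 3) + {(1, 2)})) := by
  refine hasChain_add t (k := 4 * j + 1) (fun m hm hml => ?_) l hl hlen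
  refine hasChain_add_four j (k := 1) (fun m hm hml => ?_) m hm hml
  obtain ⟨x, y, rfl⟩ := List.length_eq_two.1 hml
  exact hasChain_pair (by simpa using hm)

theorem Dec.of_hasChain {k : ℕ} (hk : 2 ≤ k) {T : Multiset (ℕ × ℕ)}
    (h : ∀ (Ω : Type) [DecidableEq Ω] (l : List Ω), l.Nodup → l.length = k → HasChain l T) :
    Dec k {k} T := by
  intro Ω _ _ l hl hlen
  obtain ⟨es, hes, -, hT, hv⟩ := h Ω l hl hlen
  exact ⟨es, hes, hT, by rw [hv, cycleType_formPerm_of_nodup hl (by omega), hlen]⟩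

theorem dec_odd (t j : ℕ) (h : 1 ≤ t + j) :
    Dec (2 * t + 4 * j + 1) {2 * t + 4 * j + 1}
      (Multiset.replicate t (2, 2) + Multiset.replicate j (3, 3)) :=
  .of_hasChain (by omega) fun _ _ l hl hlen => hasChain_odd t j l hl hlen

theorem dec_even (t j : ℕ) :
    Dec (2 * t + 4 * j + 2) {2 * t + 4 * j + 2}
      (Multiset.replicate t (2, 2) + (Multiset.replicate j (3, 3) + {(1, 2)})) :=
  .of_hasChain (by omega) fun _ _ l hl hlen => hasChain_even t j l hl hlen

theorem dec_odd' (t : ℕ) :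
    Dec (2 * t + 3) {2 * t + 3} ((2, 1) ::ₘ (1, 2) ::ₘ Multiset.replicate t (2, 2)) := by
  intro Ω _ _ l hl hlen
  obtain _ | ⟨y, _ | ⟨x, m⟩⟩ := l
  · simp at hlen
  · simp at hlen
  obtain ⟨es, hes, hhead, hT, hv⟩ := hasChain_even t 0 (x :: m) (by simp at hl ⊢; tauto)
    (by simp at hlen ⊢; omega)
  have hx : x ∉ Slot.leftPoints es := by simpa using hhead
  have hy : y ∉ x :: m := by simp at hl ⊢; tauto
  have hyL : y ∉ Slot.leftPoints es := fun h => hy (hes.3 h)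
  have hyR : y ∉ Slot.rightPoints es := fun h => hy (hes.4 h)
  have hxy : x ≠ y := fun h => hy (by simp [h])
  refine ⟨⟨[x], [], y⟩ :: es, ⟨?_, ?_, ?_, ?_⟩, ?_, ?_⟩
  · have := hes.1
    simp [Slot.leftPoints_cons, *]
  · have := hes.2
    simp [Slot.rightPoints_cons, *]
  · have := hes.3
    simp [Slot.leftPoints_cons]
    exact fun z hz => List.mem_cons_of_mem _ (this hz)
  · have := hes.4
    simp [Slot.rightPoints_cons]
    exact fun z hz => List.mem_cons_of_mem _ (this hz)
  · rw [List.map_cons, ← Multiset.cons_coe, hT]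
    simp [Slot.lengths, ← Multiset.singleton_add, add_comm]
  · have h1 := Slot.value_append (es := [⟨[x], [], y⟩]) (fs := es)
      (by simp [Slot.rightPoints_cons, Slot.rightPoints_nil, *])
      (by simp [Slot.rightPoints_cons, Slot.rightPoints_nil, *])
    rw [List.singleton_append] at h1
    have h2 : Slot.value [⟨[x], [], y⟩] * (x :: m).formPerm = (y :: x :: m).formPerm := by
      rw [List.formPerm_cons_cons, Slot.value_singleton]
      simp [Equiv.swap_comm x y]
    rw [h1, hv, h2, cycleType_formPerm_of_nodup hl (by omega), hlen]

end Chains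

section ClosedPair

variable {Ω : Type*}

/-- The slots realizing a pair of disjoint cycles of the same length. -/
def pairSlots {k : ℕ} [NeZero k] (x y : Fin k → Ω) : List (Slot Ω) :=
  List.ofFn fun i => ⟨[y (i + 1)], [y i], x i⟩

theorem valid_pairSlots {k : ℕ} [NeZero k] {x y : Fin k → Ω} (hx : Function.Injective x)
    (hy : Function.Injective y) (hxy : ∀ i j, x i ≠ y j) :
    Slot.Valid (pairSlots x y) (List.ofFn x ++ List.ofFn y) := by
  have hyx : ∀ i j, y i ≠ x j := fun i j => (hxy j i).symm
  refine ⟨?_, ?_, ?_, ?_⟩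
  · rw [Slot.leftPoints, List.nodup_flatten, pairSlots, List.map_ofFn, List.pairwise_ofFn]
    refine ⟨?_, fun i j hij => ?_⟩
    · simp [Slot.leftCycle, hyx]
    · simp [Slot.leftCycle, hyx, hxy, hx.eq_iff, hy.eq_iff, hij.ne']
  · rw [Slot.rightPoints, List.nodup_flatten, pairSlots, List.map_ofFn, List.pairwise_ofFn]
    refine ⟨?_, fun i j hij => ?_⟩
    · simp [Slot.rightCycle, hyx]
    · simp [Slot.rightCycle, hyx, hxy, hx.eq_iff, hy.eq_iff, hij.ne']
  · intro z hz
    simp [Slot.leftPoints, pairSlots, Slot.leftCycle, List.mem_flatten] at hz ⊢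
    grind
  · intro z hz
    simp [Slot.rightPoints, pairSlots, Slot.rightCycle, List.mem_flatten] at hz ⊢
    grind

variable [DecidableEq Ω]

theorem formPerm_ofFn_apply {k : ℕ} [NeZero k] {x : Fin k → Ω} (hx : Function.Injective x)
    (i : Fin k) : (List.ofFn x).formPerm (x i) = x (i + 1) := by
  have h := List.formPerm_apply_getElem (List.ofFn x) (List.nodup_ofFn.2 hx) i (by simp)
  simp only [List.getElem_ofFn, Fin.eta, List.length_ofFn] at h
  rw [h]
  congr 1
  ext
  simp [Fin.val_add]

theorem value_pairSlots {k : ℕ} [NeZero k] {x y : Fin k → Ω} (hx : Function.Injective x)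
    (hy : Function.Injective y) (hxy : ∀ i j, x i ≠ y j) :
    Slot.value (pairSlots x y) = (List.ofFn x).formPerm⁻¹ * (List.ofFn y).formPerm := by
  have hv := valid_pairSlots hx hy hxy
  have hR : ∀ i, cycleProd ((pairSlots x y).map Slot.rightCycle) (y i) = x i := fun i => by
    rw [cycleProd_apply_of_mem hv.2 (l := [y i, x i]) _ (by simp)]
    · simp
    · simp [pairSlots, Slot.rightCycle]
      exact ⟨i, rfl, rfl⟩
  have hR' : ∀ i, cycleProd ((pairSlots x y).map Slot.rightCycle) (x i) = y i := fun i => by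
    rw [cycleProd_apply_of_mem hv.2 (l := [y i, x i]) _ (by simp)]
    · simp
    · simp [pairSlots, Slot.rightCycle]
      exact ⟨i, rfl, rfl⟩
  have hL : ∀ i, cycleProd ((pairSlots x y).map Slot.leftCycle) (x i) = y (i + 1) := fun i => by
    rw [cycleProd_apply_of_mem hv.1 (l := [y (i + 1), x i]) _ (by simp)]
    · simp
    · simp [pairSlots, Slot.leftCycle]
      exact ⟨i, rfl, rfl⟩
  have hL' : ∀ i, cycleProd ((pairSlots x y).map Slot.leftCycle) (y (i + 1)) = x i := fun i => by
    rw [cycleProd_apply_of_mem hv.1 (l := [y (i + 1), x i]) _ (by simp)]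
    · simp
    · simp [pairSlots, Slot.leftCycle]
      exact ⟨i, rfl, rfl⟩
  have hnx : ∀ i, (List.ofFn y).formPerm (x i) = x i := fun i =>
    List.formPerm_apply_of_notMem (by simpa using fun j => (hxy i j).symm)
  have hny : ∀ i, (List.ofFn x).formPerm (y i) = y i := fun i =>
    List.formPerm_apply_of_notMem (by simpa using fun j => hxy j i)
  ext z
  by_cases hz : ∃ i, x i = z
  · obtain ⟨i, rfl⟩ := hz
    obtain ⟨i, rfl⟩ : ∃ j, i = j + 1 := ⟨i - 1, by simp⟩
    rw [Slot.value, Equiv.Perm.mul_apply, Equiv.Perm.mul_apply, hnx,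
      Equiv.Perm.inv_eq_iff_eq.2 (hR _).symm, hL', Equiv.Perm.inv_eq_iff_eq.2]
    exact (formPerm_ofFn_apply hx i).symm
  by_cases hz' : ∃ i, y i = z
  · obtain ⟨i, rfl⟩ := hz'
    rw [Slot.value, Equiv.Perm.mul_apply, Equiv.Perm.mul_apply, formPerm_ofFn_apply hy,
      Equiv.Perm.inv_eq_iff_eq.2 (hR' _).symm, hL, Equiv.Perm.inv_eq_iff_eq.2 (hny _).symm]
  · have hzx : z ∉ List.ofFn x := by simpa using hz
    have hzy : z ∉ List.ofFn y := by simpa using hz'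
    have hzn : z ∉ List.ofFn x ++ List.ofFn y := by simp [hzx, hzy]
    rw [Slot.value_apply_of_notMem (fun h => hzn (hv.3 h)) (fun h => hzn (hv.4 h)),
      Equiv.Perm.mul_apply, List.formPerm_apply_of_notMem hzy,
      Equiv.Perm.inv_eq_iff_eq.2 (List.formPerm_apply_of_notMem hzx).symm]

theorem dec_pair {k : ℕ} (hk : 2 ≤ k) :
    Dec (k + k) {k, k} (Multiset.replicate k (2, 2)) := by
  have : NeZero k := ⟨by omega⟩
  intro Ω _ _ l hl hlen
  obtain ⟨x, y, rfl⟩ : ∃ x y : Fin k → Ω, l = List.ofFn x ++ List.ofFn y := by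
    have key : ∀ m : List Ω, m.length = k → ∃ x : Fin k → Ω, m = List.ofFn x := by
      rintro m rfl
      exact ⟨m.get, (List.ofFn_get m).symm⟩
    obtain ⟨x, hx⟩ := key (l.take k) (by simp; omega)
    obtain ⟨y, hy⟩ := key (l.drop k) (by simp; omega)
    exact ⟨x, y, by rw [← hx, ← hy, List.take_append_drop]⟩
  rw [List.nodup_append, List.nodup_ofFn, List.nodup_ofFn] at hl
  have hxy : ∀ i j, x i ≠ y j := fun i j => hl.2.2 _ (by simp) _ (by simp)
  refine ⟨pairSlots x y, valid_pairSlots hl.1 hl.2.1 hxy, ?_, ?_⟩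
  · rw [pairSlots, List.map_ofFn, ← Multiset.coe_replicate, ← List.ofFn_const]
    rfl
  · rw [value_pairSlots hl.1 hl.2.1 hxy, Equiv.Perm.Disjoint.cycleType_mul,
      Equiv.Perm.cycleType_inv, cycleType_formPerm_of_nodup (List.nodup_ofFn.2 hl.1) (by simpa),
      cycleType_formPerm_of_nodup (List.nodup_ofFn.2 hl.2.1) (by simpa)]
    · simp
    · refine Equiv.Perm.Disjoint.inv_left ?_
      rw [formPerm_eq_cycleProd, formPerm_eq_cycleProd]
      exact cycleProd_disjoint (by simpa using fun i j => (hxy i j).symm)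

end ClosedPair

section Options

/-- The cycle type `c` is the value of `r` slots of type `(2, 2)` and `h` slots of type `(3, 3)` on
its support. -/
def Opt (c : Multiset ℕ) (r h : ℕ) : Prop :=
  Dec c.sum c (Multiset.replicate r (2, 2) + Multiset.replicate h (3, 3))

theorem opt_zero : Opt 0 0 0 := by simpa [Opt] using dec_zero

theorem Opt.add {c c' : Multiset ℕ} {r r' h h' : ℕ} (H : Opt c r h) (H' : Opt c' r' h') :
    Opt (c + c') (r + r') (h + h') := by
  have := Dec.add H H'
  rw [Opt, Multiset.sum_add, Multiset.replicate_add, Multiset.replicate_add]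
  convert this using 1
  exact add_add_add_comm _ _ _ _

theorem opt_odd (t j : ℕ) (h : 1 ≤ t + j) : Opt {2 * t + 4 * j + 1} t j := by
  simpa [Opt] using dec_odd t j h

theorem opt_evens (t j t' : ℕ) :
    Opt ({2 * t + 4 * j + 2} + {2 * t' + 2}) (t + t') (j + 1) := by
  have h := (dec_even t j).add (dec_even t' 0).flip
  have h2 := Dec.merge (x := (1, 2)) (y := (2, 1))
    (T := Multiset.replicate (t + t') (2, 2) + Multiset.replicate j (3, 3)) (by
      convert h using 1
      simp only [Multiset.map_add, Multiset.map_replicate, Multiset.map_singleton,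
        Multiset.replicate_add, Multiset.replicate_zero, ← Multiset.singleton_add, zero_add,
        Prod.swap_prod_mk]
      abel)
  rw [Opt, Multiset.replicate_succ, Multiset.add_cons]
  simpa using h2

theorem opt_closed {k : ℕ} (hk : 2 ≤ k) : Opt ({k} + {k}) k 0 := by
  simpa [Opt] using dec_pair hk

theorem opt_alt (m : ℕ) : Opt ({m + 2} + {m + 2}) m 1 := by
  obtain ⟨t, rfl⟩ | ⟨t, rfl⟩ := m.even_or_odd
  · have := opt_evens t 0 t
    simpa [two_mul] using this
  · have h := (dec_odd (t + 1) 0 (by omega)).add (dec_odd' t)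
    have h2 := Dec.merge (x := (2, 1)) (y := (1, 2))
      (T := Multiset.replicate (2 * t + 1) (2, 2)) (by
        convert h using 1
        simp only [Multiset.replicate_add, Multiset.replicate_zero, ← Multiset.singleton_add,
          two_mul, Multiset.replicate_one]
        abel)
    rw [Opt, Multiset.replicate_one, add_comm (Multiset.replicate _ _), Multiset.singleton_add]
    convert h2 using 1
    · simp; ring
    · rw [show 2 * (t + 1) + 4 * 0 + 1 = 2 * t + 1 + 2 by ring]
      rfl
    · rfl

/-- Cycle types of nontrivial cycles of even permutations. -/
structure EvenType (c : Multiset ℕ) : Prop where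
  two_le : ∀ k ∈ c, 2 ≤ k
  even : Even (c.sum + c.card)

theorem EvenType.of_add {c c' : Multiset ℕ} (h : EvenType (c + c'))
    (hc : Even (c.sum + c.card)) : EvenType c' := by
  refine ⟨fun k hk => h.1 k (by simp [hk]), ?_⟩
  have h2 := h.2
  rw [Multiset.sum_add, Multiset.card_add] at h2
  grind

theorem EvenType.exists_opt {c : Multiset ℕ} (hc : EvenType c) : ∃ r h, h ≤ r ∧ Opt c r h := by
  induction hn : c.card using Nat.strong_induction_on generalizing c with
  | _ n ih =>
    subst hn
    by_cases hodd : ∃ k ∈ c, Odd k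
    · obtain ⟨k, hk, t, rfl⟩ := hodd
      obtain ⟨c', rfl⟩ := Multiset.exists_cons_of_mem hk
      rw [← Multiset.singleton_add] at hc ⊢
      have ht := hc.1 (2 * t + 1) (by simp)
      obtain ⟨r, h, hr, ho⟩ := ih _ (by simp) (hc.of_add (by simp; exact ⟨t + 1, by ring⟩)) rfl
      exact ⟨t + r, 0 + h, by omega, (opt_odd t 0 (by omega)).add ho⟩
    · push Not at hodd
      have hs : Even c.sum := Multiset.sum_induction Even c (fun _ _ => Even.add) ⟨0, rfl⟩
        fun k hk => by simpa using hodd k hk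
      have hcard : Even c.card := by have := hc.2; grind
      obtain rfl | ⟨a, ha⟩ := c.empty_or_exists_mem
      · exact ⟨0, 0, le_rfl, opt_zero⟩
      obtain ⟨c', rfl⟩ := Multiset.exists_cons_of_mem ha
      obtain rfl | ⟨b, hb⟩ := c'.empty_or_exists_mem
      · simp at hcard
      obtain ⟨c', rfl⟩ := Multiset.exists_cons_of_mem hb
      have e : a ::ₘ b ::ₘ c' = ({a} + {b}) + c' := by simp
      rw [e] at hc hodd ih ⊢
      have ha2 := hc.1 a (by simp)
      have hb2 := hc.1 b (by simp)
      obtain ⟨t, ht⟩ : Even a := by simpa using hodd a (by simp)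
      obtain ⟨t', ht'⟩ : Even b := by simpa using hodd b (by simp)
      obtain ⟨r, h, hr, ho⟩ := ih c'.card (by simp)
        (hc.of_add (by simp; exact ⟨t + t' + 1, by rw [ht, ht']; ring⟩)) rfl
      by_cases hab : a = b
      · subst hab
        exact ⟨a + r, 0 + h, by omega, (opt_closed ha2).add ho⟩
      · have := opt_evens (t - 1) 0 (t' - 1)
        rw [show 2 * (t - 1) + 4 * 0 + 2 = a by omega, show 2 * (t' - 1) + 2 = b by omega] at this
        exact ⟨_, _, by omega, this.add ho⟩

/-- The number `2 r + 3 h` can take `m + 1` consecutive values. -/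
def Flex (m : ℕ) (c : Multiset ℕ) : Prop :=
  ∃ U, ∀ j ≤ m, ∃ r h, h ≤ r ∧ 2 * r + 3 * h = U + j ∧ Opt c r h

theorem Flex.add {m m' : ℕ} {c c' : Multiset ℕ} (H : Flex m c) (H' : Flex m' c') :
    Flex (m + m') (c + c') := by
  obtain ⟨U, hU⟩ := H
  obtain ⟨U', hU'⟩ := H'
  refine ⟨U + U', fun j hj => ?_⟩
  obtain ⟨r, h, h1, h2, h3⟩ := hU (min j m) (min_le_right _ _)
  obtain ⟨r', h', h1', h2', h3'⟩ := hU' (j - min j m) (by omega)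
  exact ⟨r + r', h + h', by omega, by omega, h3.add h3'⟩

theorem EvenType.flex_zero {c : Multiset ℕ} (hc : EvenType c) : Flex 0 c := by
  obtain ⟨r, h, h1, h2⟩ := hc.exists_opt
  exact ⟨2 * r + 3 * h, fun j hj => ⟨r, h, h1, by omega, h2⟩⟩

theorem flex_two_pairs (m m' : ℕ) :
    Flex 1 (({m + 2} + {m + 2}) + ({m' + 2} + {m' + 2})) := by
  refine ⟨2 * m + 2 * m' + 7, fun j hj => ?_⟩
  obtain rfl | rfl : j = 0 ∨ j = 1 := by omega
  · exact ⟨_, _, by omega, by ring, (opt_alt m).add (opt_closed (by omega : 2 ≤ m' + 2))⟩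
  · exact ⟨_, _, by omega, by ring,
      (opt_closed (by omega : 2 ≤ m + 2)).add (opt_closed (by omega : 2 ≤ m' + 2))⟩

theorem flex_odd {t m : ℕ} (ht : 1 ≤ t) (h : 3 * m ≤ t) : Flex m {2 * t + 1} := by
  refine ⟨2 * t - m, fun j hj => ?_⟩
  have := opt_odd (t - 2 * (m - j)) (m - j) (by omega)
  rw [show 2 * (t - 2 * (m - j)) + 4 * (m - j) + 1 = 2 * t + 1 by omega] at this
  exact ⟨_, _, by omega, by omega, this⟩

theorem flex_even {t t' m : ℕ} (h : 3 * m + 2 ≤ t) :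
    Flex m ({2 * t + 2} + {2 * t' + 2}) := by
  refine ⟨2 * t + 2 * t' + 3 - m, fun j hj => ?_⟩
  have := opt_evens (t - 2 * (m - j)) (m - j) t'
  rw [show 2 * (t - 2 * (m - j)) + 4 * (m - j) + 2 = 2 * t + 2 by omega] at this
  exact ⟨_, _, by omega, by omega, this⟩

theorem exists_pair_of_lt {L : ℕ} {c : Multiset ℕ} (hL : ∀ k ∈ c, k < L) (hc : L < c.card) :
    ∃ k c', c = ({k} + {k}) + c' := by
  have hn : ¬ c.Nodup := by
    intro hn
    have h1 := Multiset.toFinset_card_of_nodup hn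
    have h2 : c.toFinset ⊆ Finset.range L := fun k hk => by
      simpa using hL k (by simpa using hk)
    have h3 := Finset.card_le_card h2
    rw [Finset.card_range] at h3
    omega
  rw [Multiset.nodup_iff_le] at hn
  push Not at hn
  obtain ⟨k, hk⟩ := hn
  obtain ⟨c', rfl⟩ := Multiset.le_iff_exists_add.1 hk
  exact ⟨k, c', by simp⟩

theorem EvenType.flex_of_lt {L : ℕ} (Q : ℕ) {c : Multiset ℕ} (hc : EvenType c)
    (hL : ∀ k ∈ c, k < L) (hcard : L + 4 * Q ≤ c.card) : Flex Q c := by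
  induction Q generalizing c with
  | zero => exact hc.flex_zero
  | succ Q ih =>
    obtain ⟨k, c, rfl⟩ := exists_pair_of_lt hL (by omega)
    obtain ⟨k', c, rfl⟩ := exists_pair_of_lt (fun a ha => hL a (by simp [ha])) (c := c) (by
      simp at hcard; omega)
    obtain ⟨m, rfl⟩ := Nat.exists_eq_add_of_le' (hc.1 k (by simp))
    obtain ⟨m', rfl⟩ := Nat.exists_eq_add_of_le' (hc.1 k' (by simp))
    rw [← add_assoc] at hc hcard hL ⊢
    rw [add_comm Q 1]
    refine (flex_two_pairs m m').add (ih (hc.of_add ?_) (fun k hk => hL k (by simp [hk])) ?_)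
    · simp
      exact ⟨m + m' + 6, by ring⟩
    · simp at hcard; omega

theorem EvenType.exists_flex (Q : ℕ) :
    ∃ N, ∀ c, EvenType c → N ≤ c.sum → Flex Q c := by
  set L := 6 * Q + 12 with hLdef
  refine ⟨(L + 4 * Q) * L + 1, fun c hc hN => ?_⟩
  by_cases hbig : ∃ k ∈ c, L ≤ k
  · obtain ⟨k, hk, hLk⟩ := hbig
    obtain ⟨c, rfl⟩ := Multiset.exists_cons_of_mem hk
    rw [← Multiset.singleton_add] at hc ⊢
    obtain ⟨t, ht⟩ | ⟨t, rfl⟩ := k.even_or_odd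
    · have hex : ∃ k' ∈ c, Even k' := by
        by_contra! hno
        have he : Even (c.sum + c.card) := by
          have : Even ((c.map (· + 1)).sum) :=
            Multiset.sum_induction Even _ (fun _ _ => Even.add) ⟨0, rfl⟩ fun k hk => by
              obtain ⟨b, hb, rfl⟩ := Multiset.mem_map.1 hk
              exact (Nat.not_even_iff_odd.1 (hno b hb)).add_one
          simpa [Multiset.sum_map_add] using this
        have h2 := hc.2
        rw [Multiset.sum_add, Multiset.card_add, Multiset.sum_singleton,
          Multiset.card_singleton] at h2
        grind
      obtain ⟨k', hk', t', ht'⟩ := hex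
      obtain ⟨c, rfl⟩ := Multiset.exists_cons_of_mem hk'
      rw [← Multiset.singleton_add, ← add_assoc] at hc ⊢
      have h2 := hc.1 k' (by simp)
      have hf := flex_even (t := t - 1) (t' := t' - 1) (m := Q) (by omega)
      rw [show 2 * (t - 1) + 2 = k by omega, show 2 * (t' - 1) + 2 = k' by omega] at hf
      refine hf.add (hc.of_add ?_).flex_zero
      simp
      exact ⟨t + t' + 1, by rw [ht, ht']; ring⟩
    · refine (flex_odd (m := Q) (by omega) (by omega)).add (hc.of_add ?_).flex_zero
      simp
      exact ⟨t + 1, by ring⟩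
  · push Not at hbig
    refine hc.flex_of_lt Q hbig ?_
    by_contra! hlt
    have h1 := Multiset.sum_le_card_nsmul c L fun k hk => (hbig k hk).le
    rw [smul_eq_mul] at h1
    have h2 := Nat.mul_le_mul_right L hlt.le
    omega

end Options

section Packing

theorem Dec.merge_sum {s : ℕ} {c : Multiset ℕ} {S T : Multiset (ℕ × ℕ)} (hS : S ≠ 0)
    (h : Dec s c (S + T)) : Dec s c (S.sum ::ₘ T) := by
  induction S using Multiset.induction_on generalizing T with
  | empty => exact absurd rfl hS
  | cons a S ih =>
    obtain rfl | hS' := eq_or_ne S 0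
    · simpa using h
    rw [Multiset.sum_cons, add_comm]
    refine Dec.merge (ih hS' ?_)
    rwa [Multiset.add_cons, ← Multiset.cons_add]

theorem Dec.merge_nsmul {s : ℕ} {c : Multiset ℕ} {S T : Multiset (ℕ × ℕ)} (hS : S ≠ 0) (r : ℕ)
    (h : Dec s c (r • S + T)) : Dec s c (Multiset.replicate r S.sum + T) := by
  induction r generalizing T with
  | zero => simpa using h
  | succ r ih =>
    rw [Multiset.replicate_succ, Multiset.cons_add, ← Multiset.add_cons]
    refine ih ?_
    rw [succ_nsmul', add_assoc] at h
    rw [Multiset.add_cons]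
    exact h.merge_sum hS

theorem exists_pack {d r h : ℕ} (hd : 6 ≤ d) (hde : Even d) (hh : Even h) (hr : h ≤ r)
    (hsum : d ≤ 2 * r + 3 * h) :
    ∃ r' h', 2 * r' + 3 * h' = d ∧ r' ≤ r ∧ h' ≤ h ∧ h - h' ≤ r - r' := by
  obtain ⟨e, rfl⟩ := hde
  obtain ⟨f, rfl⟩ := hh
  by_cases hq : 2 * (e / 3) ≤ f + f
  · exact ⟨e % 3, 2 * (e / 3), by omega, by omega, by omega, by omega⟩
  · exact ⟨e - 3 * f, f + f, by omega, by omega, by omega, by omega⟩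

theorem Dec.pack {d : ℕ} (hd : 6 ≤ d) (hde : Even d) {s : ℕ} {c : Multiset ℕ} (m : ℕ) {r h : ℕ}
    {T : Multiset (ℕ × ℕ)} (hr : h ≤ r) (hsum : 2 * r + 3 * h = d * m)
    (H : Dec s c (Multiset.replicate r (2, 2) + Multiset.replicate h (3, 3) + T)) :
    Dec s c (Multiset.replicate m (d, d) + T) := by
  induction m generalizing r h T with
  | zero =>
    obtain ⟨rfl, rfl⟩ : r = 0 ∧ h = 0 := by omega
    simpa using H
  | succ m ih =>
    have hh : Even h := by
      have : Even (d * (m + 1)) := hde.mul_right _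
      grind
    obtain ⟨r', h', h1, h2, h3, h4⟩ := exists_pack hd hde hh hr (by rw [hsum]; nlinarith)
    obtain ⟨r, rfl⟩ := Nat.exists_eq_add_of_le h2
    obtain ⟨h, rfl⟩ := Nat.exists_eq_add_of_le h3
    rw [Multiset.replicate_succ, Multiset.cons_add, ← Multiset.add_cons]
    refine ih (r := r) (h := h) (by omega) (by rw [mul_add_one d m] at hsum; omega) ?_
    rw [Multiset.add_cons]
    have e : (Multiset.replicate r' (2, 2) + Multiset.replicate h' (3, 3)).sum = (d, d) := by
      rw [← h1]
      simp [mul_comm]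
    rw [← e]
    refine Dec.merge_sum ?_ ?_
    · intro h0
      rw [h0] at e
      have := congrArg Prod.fst e
      simp at this
      omega
    · convert H using 1
      simp only [Multiset.replicate_add]
      abel

theorem dec_ones (k : ℕ) : Dec k 0 (Multiset.replicate k (1, 1)) := by
  induction k with
  | zero => exact dec_zero
  | succ k ih =>
    have := ih.add dec_one
    rw [Multiset.replicate_add]
    simpa using this

theorem Dec.absorb {d : ℕ} (hd : 6 ≤ d) {s : ℕ} {c : Multiset ℕ} {r h : ℕ} (b : ℕ)
    (H : Dec s c (Multiset.replicate r (2, 2) + Multiset.replicate h (3, 3))) :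
    Dec (s + (r * (d - 2) + h * (d - 3) + b * d)) c (Multiset.replicate (r + h + b) (d, d)) := by
  have h1 := H.add (dec_ones (r * (d - 2) + h * (d - 3) + b * d))
  rw [add_zero] at h1
  set A : Multiset (ℕ × ℕ) := {(2, 2)} + Multiset.replicate (d - 2) (1, 1) with hA
  set B : Multiset (ℕ × ℕ) := {(3, 3)} + Multiset.replicate (d - 3) (1, 1) with hB
  set C : Multiset (ℕ × ℕ) := Multiset.replicate d (1, 1) with hC
  have hAs : A.sum = (d, d) := by
    simp [hA]; omega
  have hBs : B.sum = (d, d) := by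
    simp [hB]; omega
  have hCs : C.sum = (d, d) := by
    simp [hC]
  have hC0 : C ≠ 0 := by
    intro h0
    rw [h0] at hCs
    have := congrArg Prod.fst hCs
    simp at this
    omega
  have h2 : Dec (s + (r * (d - 2) + h * (d - 3) + b * d)) c (r • A + (h • B + (b • C + 0))) := by
    convert h1 using 1
    simp only [hA, hB, hC, nsmul_add, Multiset.nsmul_singleton, Multiset.nsmul_replicate,
      Multiset.replicate_add]
    abel
  have h3 := h2.merge_nsmul (by simp [hA]) r
  rw [add_left_comm (Multiset.replicate r A.sum)] at h3
  have h4 := h3.merge_nsmul (by simp [hB]) h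
  rw [add_left_comm (Multiset.replicate r A.sum) (b • C),
    add_left_comm (Multiset.replicate h B.sum) (b • C)] at h4
  have h5 := h4.merge_nsmul hC0 b
  rw [hAs, hBs, hCs] at h5
  convert h5 using 1
  simp only [Multiset.replicate_add]
  abel

theorem Slot.length_le_leftPoints {Ω : Type*} (es : List (Slot Ω)) :
    es.length ≤ (Slot.leftPoints es).length := by
  induction es with
  | nil => simp
  | cons e es ih =>
    rw [Slot.leftPoints_cons]
    simp
    omega

theorem Dec.card_le {s : ℕ} {c : Multiset ℕ} {T : Multiset (ℕ × ℕ)} (H : Dec s c T) :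
    T.card ≤ s := by
  obtain ⟨es, hes, rfl, -⟩ := H (Fin s) (List.finRange s) (List.nodup_finRange s) (by simp)
  have h1 := Slot.length_le_leftPoints es
  have h2 := hes.1.length_le_card
  simp at h2 ⊢
  omega

theorem EvenType.exists_dec {d M : ℕ} (hd : 6 ≤ d) (hde : Even d) (hM : 1 ≤ M) :
    ∃ N, ∀ c, EvenType c → ∀ s, c.sum ≤ s → N ≤ s →
      ∃ a, 1 ≤ a ∧ Dec s c (Multiset.replicate (M * a) (d, d)) := by
  obtain ⟨N, hN⟩ := EvenType.exists_flex (d * M)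
  refine ⟨N + d * (M * (N + 1)), fun c hc s hcs hs => ?_⟩
  by_cases hcN : N ≤ c.sum
  · obtain ⟨U, hU⟩ := hN c hc hcN
    obtain ⟨r, h, h1, h2, h3⟩ := hU (d * M - U % (d * M)) (Nat.sub_le _ _)
    have hpos : 0 < d * M := Nat.mul_pos (by omega) hM
    have hmod := Nat.mod_lt U hpos
    have hdiv := Nat.div_add_mod U (d * M)
    refine ⟨U / (d * M) + 1, Nat.le_add_left 1 _, ?_⟩
    have := Dec.pack hd hde (M * (U / (d * M) + 1)) (T := 0) h1
      (by rw [h2, ← mul_assoc, mul_add]; omega) (by rw [add_zero]; exact h3)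
    simpa using this.mono hcs
  · obtain ⟨r, h, h1, h2⟩ := hc.exists_opt
    have hcard := Dec.card_le h2
    rw [Multiset.card_add, Multiset.card_replicate, Multiset.card_replicate] at hcard
    refine ⟨r + h + 1, by omega, ?_⟩
    have hle : r + h ≤ M * (r + h + 1) := by nlinarith
    have h3 := Dec.absorb hd (M * (r + h + 1) - (r + h)) h2
    rw [show r + h + (M * (r + h + 1) - (r + h)) = M * (r + h + 1) by omega] at h3
    refine h3.mono (le_trans (Nat.add_le_add (by omega) ?_) hs)
    calc r * (d - 2) + h * (d - 3) + (M * (r + h + 1) - (r + h)) * d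
        ≤ r * d + h * d + (M * (r + h + 1) - (r + h)) * d := by gcongr <;> omega
      _ = (r + h + (M * (r + h + 1) - (r + h))) * d := by ring
      _ = d * (M * (r + h + 1)) := by
        rw [show r + h + (M * (r + h + 1) - (r + h)) = M * (r + h + 1) by omega, mul_comm]
      _ ≤ d * (M * (N + 1)) := by gcongr; omega

/-- Every even permutation of sufficiently many points is a product of two permutations which
consist of cycles of length `d`, with the number of cycles a multiple of `M`. -/
theorem exists_eq_mul_of_sign_eq_one {d M : ℕ} (hd : 6 ≤ d) (hde : Even d) (hM : 1 ≤ M) :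
    ∃ N, ∀ n, N ≤ n → ∀ g : Equiv.Perm (Fin n), Equiv.Perm.sign g = 1 →
      ∃ a, 1 ≤ a ∧ ∃ s t : Equiv.Perm (Fin n), g = s * t ∧
        s.cycleType = Multiset.replicate (M * a) d ∧
        t.cycleType = Multiset.replicate (M * a) d := by
  obtain ⟨N, hN⟩ := EvenType.exists_dec hd hde hM
  refine ⟨N, fun n hn g hg => ?_⟩
  have hc : EvenType g.cycleType := by
    refine ⟨fun k hk => Equiv.Perm.two_le_of_mem_cycleType hk, ?_⟩
    rw [Equiv.Perm.sign_of_cycleType] at hg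
    by_contra hodd
    rw [Nat.not_even_iff_odd] at hodd
    rw [hodd.neg_one_pow] at hg
    exact absurd hg (by decide)
  have hs : g.cycleType.sum ≤ n := by
    rw [Equiv.Perm.sum_cycleType]
    simpa using Finset.card_le_univ g.support
  obtain ⟨a, ha, H⟩ := hN _ hc n hs hn
  refine ⟨a, ha, ?_⟩
  obtain ⟨es, hes, hT, hcyc⟩ := H (Fin n) (List.finRange n) (List.nodup_finRange n) (by simp)
  have hlen : es.length = M * a := by simpa using congrArg Multiset.card hT
  have hmem : ∀ e ∈ es, e.lengths = (d, d) := fun e he => by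
    refine Multiset.eq_of_mem_replicate (n := M * a) ?_
    rw [← hT]
    exact List.mem_map_of_mem he
  obtain ⟨k, hk⟩ := isConj_iff.1 (Equiv.Perm.isConj_iff_cycleType_eq.2 hcyc)
  set L := cycleProd (es.map Slot.leftCycle) with hL
  set R := cycleProd (es.map Slot.rightCycle) with hR
  have hLc : L.cycleType = Multiset.replicate (M * a) d := by
    rw [hL, cycleProd_cycleType hes.1 (d := d) (by omega), List.length_map, hlen]
    intro l hl
    obtain ⟨e, he, rfl⟩ := List.mem_map.1 hl
    simpa [Slot.leftCycle, Slot.lengths] using congrArg Prod.fst (hmem e he)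
  have hRc : R.cycleType = Multiset.replicate (M * a) d := by
    rw [hR, cycleProd_cycleType hes.2 (d := d) (by omega), List.length_map, hlen]
    intro l hl
    obtain ⟨e, he, rfl⟩ := List.mem_map.1 hl
    simpa [Slot.rightCycle, Slot.lengths] using congrArg Prod.snd (hmem e he)
  refine ⟨k * L * k⁻¹, k * R⁻¹ * k⁻¹, ?_, ?_, ?_⟩
  · rw [← hk, Slot.value, ← hL, ← hR]
    group
  · rw [Equiv.Perm.cycleType_conj, hLc]
  · rw [Equiv.Perm.cycleType_conj, Equiv.Perm.cycleType_inv, hRc]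

end Packing

section WordValues

theorem map_mem_wordImage {d : ℕ} {w : FreeGroup (Fin d)} {G H : Type*} [Group G] [Group H]
    (φ : G →* H) {g : G} (hg : g ∈ wordImage w G) : φ g ∈ wordImage w H := by
  obtain ⟨f, rfl⟩ := hg
  refine ⟨φ ∘ f, ?_⟩
  have : FreeGroup.lift (φ ∘ f) = φ.comp (FreeGroup.lift f) := by
    ext i
    simp
  simp [this]

theorem exists_mem_wordImage_of_surjective {d : ℕ} {w : FreeGroup (Fin d)} {G H : Type*} [Group G]
    [Group H] {φ : G →* H} (hφ : Function.Surjective φ) {h : H} (hh : h ∈ wordImage w H) :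
    ∃ g ∈ wordImage w G, φ g = h := by
  obtain ⟨f, rfl⟩ := hh
  choose s hs using hφ
  refine ⟨FreeGroup.lift (s ∘ f) w, ⟨_, rfl⟩, ?_⟩
  have : φ.comp (FreeGroup.lift (s ∘ f)) = FreeGroup.lift f := by
    ext i
    simp [hs]
  simp [← this]

theorem cycleType_of_semiregular {β : Type*} [Fintype β] [DecidableEq β] {τ : Equiv.Perm β} {d : ℕ}
    (hd : 2 ≤ d) (h : ∀ x k, (τ ^ k) x = x ↔ d ∣ k) {m : ℕ} (hm : Fintype.card β = m * d) :
    τ.cycleType = Multiset.replicate m d := by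
  have h1 : ∀ l ∈ τ.cycleType, l = d := by
    intro l hl
    rw [Equiv.Perm.cycleType_def, Multiset.mem_map] at hl
    obtain ⟨c, hc, rfl⟩ := hl
    have hc' : c ∈ τ.cycleFactorsFinset := hc
    rw [Equiv.Perm.mem_cycleFactorsFinset_iff] at hc'
    obtain ⟨x, hx, -⟩ := hc'.1
    have hpow : ∀ k, (c ^ k) x = (τ ^ k) x := fun k => by
      induction k with
      | zero => rfl
      | succ k ih =>
        rw [pow_succ', pow_succ', Equiv.Perm.mul_apply, Equiv.Perm.mul_apply, ← ih]
        exact hc'.2 _ (Equiv.Perm.pow_apply_mem_support.2 (Equiv.Perm.mem_support.2 hx))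
    have key : ∀ k, c.support.card ∣ k ↔ d ∣ k := fun k => by
      rw [← hc'.1.orderOf, orderOf_dvd_iff_pow_eq_one, hc'.1.pow_eq_one_iff' hx, hpow, h]
    exact Nat.dvd_antisymm ((key _).2 dvd_rfl) ((key _).1 dvd_rfl)
  have h2 := Multiset.eq_replicate_card.2 h1
  have h3 : τ.support = Finset.univ := by
    ext x
    simp only [Equiv.Perm.mem_support, Finset.mem_univ, iff_true]
    intro hx
    have := (h x 1).1 (by simpa using hx)
    rw [Nat.dvd_one] at this
    omega
  have h4 := τ.sum_cycleType
  rw [h3, Finset.card_univ, hm, h2, Multiset.sum_replicate, smul_eq_mul] at h4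
  rw [h2, Nat.eq_of_mul_eq_mul_right (by omega) h4]

/-- The action of a group on `2 c` copies of itself. -/
def copiesHom (I : Type*) [Group I] (c : ℕ) : I →* Equiv.Perm (Bool × Fin c × I) where
  toFun i := Equiv.prodCongrRight fun _ => Equiv.prodCongrRight fun _ => Equiv.mulLeft i
  map_one' := by ext x <;> simp
  map_mul' i j := by ext x <;> simp

theorem copiesHom_apply {I : Type*} [Group I] {c : ℕ} (i : I) (x : Bool × Fin c × I) :
    copiesHom I c i x = (x.1, x.2.1, i * x.2.2) := rfl

theorem sign_copiesHom {I : Type*} [Group I] [Fintype I] [DecidableEq I] {c : ℕ} (i : I) :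
    Equiv.Perm.sign (copiesHom I c i) = 1 := by
  have h : copiesHom I c i =
    Equiv.prodCongrRight fun _ => Equiv.prodCongrRight fun _ => Equiv.mulLeft i := rfl
  rw [h, Equiv.Perm.sign_prodCongrRight]
  simp

theorem mem_wordImage_alternatingGroup {dd : ℕ} {w : FreeGroup (Fin dd)} {I : Type*} [Group I]
    [Fintype I] {y : I} (hy : y ∈ wordImage w I) {d : ℕ} (hd : 2 ≤ d) (hyd : orderOf y = d)
    {n c m : ℕ} {σ : alternatingGroup (Fin n)} (hm : 2 * c * Fintype.card I = m * d)
    (hσ : (σ : Equiv.Perm (Fin n)).cycleType = Multiset.replicate m d) :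
    σ ∈ wordImage w (alternatingGroup (Fin n)) := by
  classical
  have hcard : Fintype.card (Bool × Fin c × I) = m * d := by
    simp [← hm, mul_assoc]
  have hτ : (copiesHom I c y).cycleType = Multiset.replicate m d := by
    refine cycleType_of_semiregular hd (fun x k => ?_) hcard
    rw [← map_pow, copiesHom_apply, ← hyd, orderOf_dvd_iff_pow_eq_one]
    constructor
    · intro h
      simpa using congrArg (fun z => z.2.2) h
    · intro h
      rw [h]
      simp
  have hle : Fintype.card (Bool × Fin c × I) ≤ Fintype.card (Fin n) := by
    have h1 := (σ : Equiv.Perm (Fin n)).sum_cycleType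
    rw [hσ, Multiset.sum_replicate, smul_eq_mul] at h1
    rw [hcard, h1]
    exact Finset.card_le_univ _
  obtain ⟨e⟩ := Function.Embedding.nonempty_of_card_le hle
  let f : (Bool × Fin c × I) ≃ {x // x ∈ Set.range e} := Equiv.ofInjective e e.injective
  have hconj : IsConj ((copiesHom I c y).extendDomain f) (σ : Equiv.Perm (Fin n)) := by
    rw [Equiv.Perm.isConj_iff_cycleType_eq, Equiv.Perm.cycleType_extendDomain, hσ, hτ]
  obtain ⟨k, hk⟩ := isConj_iff.1 hconj
  let φ : I →* Equiv.Perm (Fin n) := (MulAut.conj k).toMonoidHom.comp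
    ((Equiv.Perm.extendDomainHom f).comp (copiesHom I c))
  have hφ : ∀ i, φ i = k * (copiesHom I c i).extendDomain f * k⁻¹ := fun i => rfl
  have hsign : ∀ i, φ i ∈ alternatingGroup (Fin n) := fun i => by
    rw [Equiv.Perm.mem_alternatingGroup, hφ]
    simp [Equiv.Perm.sign_extendDomain, sign_copiesHom]
  have := map_mem_wordImage (φ.codRestrict _ hsign) hy
  convert this
  ext1
  rw [← hk, ← hφ]
  rfl

end WordValues

open scoped commutatorElement

/-- A perfect central extension of the alternating group, given as a homomorphism into the
symmetric group. -/
structure AltCover {α G : Type*} [Fintype α] [DecidableEq α] [Group G] (π : G →* Equiv.Perm α) :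
    Prop where
  range_eq : π.range = alternatingGroup α
  central : ∀ z, π z = 1 → ∀ g, z * g = g * z
  perfect : commutator G = ⊤

namespace AltCover

variable {α G : Type*} [Fintype α] [DecidableEq α] [Group G] {π : G →* Equiv.Perm α}

theorem exists_lift (hπ : AltCover π) {σ : Equiv.Perm α} (hσ : Equiv.Perm.sign σ = 1) :
    ∃ g, π g = σ := by
  have : σ ∈ π.range := by rwa [hπ.range_eq, Equiv.Perm.mem_alternatingGroup]
  exact this

theorem sign_eq (hπ : AltCover π) (g : G) : Equiv.Perm.sign (π g) = 1 := by
  have : π g ∈ π.range := ⟨g, rfl⟩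
  rwa [hπ.range_eq, Equiv.Perm.mem_alternatingGroup] at this

theorem exists_central (hπ : AltCover π) {a b : G} (h : π a = π b) :
    ∃ z, a = b * z ∧ ∀ g, z * g = g * z :=
  ⟨b⁻¹ * a, by group, hπ.central _ (by simp [h])⟩

theorem commutator_congr (hπ : AltCover π) {a a' b b' : G} (ha : π a = π a') (hb : π b = π b') :
    ⁅a, b⁆ = ⁅a', b'⁆ := by
  obtain ⟨z, rfl, hz⟩ := hπ.exists_central ha
  obtain ⟨w, rfl, hw⟩ := hπ.exists_central hb
  simp only [commutatorElement_def, mul_inv_rev]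
  calc a' * z * (b' * w) * (z⁻¹ * a'⁻¹) * (w⁻¹ * b'⁻¹)
      = a' * (z * (b' * w)) * z⁻¹ * a'⁻¹ * w⁻¹ * b'⁻¹ := by group
    _ = a' * b' * (w * a'⁻¹) * w⁻¹ * b'⁻¹ := by rw [hz]; group
    _ = a' * b' * a'⁻¹ * b'⁻¹ := by rw [hw]; group

theorem commute_congr (hπ : AltCover π) {a a' b b' : G} (ha : π a = π a') (hb : π b = π b')
    (h : Commute a' b') : Commute a b := by
  rw [← commutatorElement_eq_one_iff_commute] at h ⊢
  rw [hπ.commutator_congr ha hb, h]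

theorem commute_commutator (hπ : AltCover π) {x a b : G} (ha : Commute (π x) (π a))
    (hb : Commute (π x) (π b)) : Commute x ⁅a, b⁆ := by
  have h : ∀ c, Commute (π x) (π c) → π (x * c * x⁻¹) = π c := fun c hc => by
    rw [map_mul, map_mul, hc.eq, map_inv, mul_inv_cancel_right]
  have h1 := hπ.commutator_congr (h a ha) (h b hb)
  rw [← conjugate_commutatorElement] at h1
  exact mul_inv_eq_iff_eq_mul.1 h1

theorem commute_of_perfect (hπ : AltCover π) {B : Type*} [Group B] (hB : commutator B = ⊤)
    (θ : B →* Equiv.Perm α) (hθ : ∀ b, Equiv.Perm.sign (θ b) = 1) {x : G}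
    (hx : ∀ b, Commute (π x) (θ b)) {b : B} {g : G} (hg : π g = θ b) : Commute x g := by
  have hle : commutator B ≤ ((Subgroup.centralizer {x}).map π).comap θ := by
    rw [commutator_def, Subgroup.commutator_le]
    intro u _ v _
    obtain ⟨u', hu⟩ := hπ.exists_lift (hθ u)
    obtain ⟨v', hv⟩ := hπ.exists_lift (hθ v)
    refine ⟨⁅u', v'⁆, ?_, ?_⟩
    · rw [SetLike.mem_coe, Subgroup.mem_centralizer_singleton_iff]
      exact (hπ.commute_commutator (hu ▸ hx u) (hv ▸ hx v)).symm.eq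
    · rw [map_commutatorElement, map_commutatorElement, hu, hv]
  rw [hB] at hle
  obtain ⟨g', hg', hgb⟩ := hle (Subgroup.mem_top b)
  rw [SetLike.mem_coe, Subgroup.mem_centralizer_singleton_iff] at hg'
  refine hπ.commute_congr rfl (hg.trans hgb.symm) hg'.symm

/-- Lifts of even permutations with disjoint supports commute. -/
theorem commute_of_disjoint (hπ : AltCover π) {S : Finset α} (hS : 5 ≤ S.card) {x y : G}
    (hx : ∀ s ∈ S, π x s = s) (hy : ∀ s, s ∉ S → π y s = s) : Commute x y := by
  have h5 : 5 ≤ Nat.card S := by simpa using hS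
  let θ : alternatingGroup S →* Equiv.Perm α :=
    Equiv.Perm.ofSubtype.comp (alternatingGroup S).subtype
  have hmem : ∀ s, s ∈ S ↔ π y s ∈ S := fun s => by
    by_cases hs : s ∈ S
    · refine ⟨fun _ => ?_, fun _ => hs⟩
      by_contra hn
      have h := (π y).injective (hy _ hn)
      exact hn (h.symm ▸ hs)
    · rw [hy s hs]
  have hyS : Equiv.Perm.ofSubtype ((π y).subtypePerm (p := (· ∈ S)) fun s => (hmem s).symm) = π y :=
    Equiv.Perm.ofSubtype_subtypePerm _ fun s hs => by
      by_contra hn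
      exact hs (hy s hn)
  have hsign : (π y).subtypePerm (p := (· ∈ S)) (fun s => (hmem s).symm) ∈ alternatingGroup S := by
    rw [Equiv.Perm.mem_alternatingGroup, ← Equiv.Perm.sign_ofSubtype, hyS, hπ.sign_eq]
  refine hπ.commute_of_perfect (commutator_alternatingGroup_eq_top h5) θ (fun b => ?_) (fun b => ?_)
    (b := ⟨_, hsign⟩) hyS.symm
  · exact (Equiv.Perm.sign_ofSubtype _).trans b.2
  · refine Equiv.Perm.Disjoint.commute fun s => ?_
    by_cases hs : s ∈ S
    · exact Or.inl (hx s hs)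
    · exact Or.inr (Equiv.Perm.ofSubtype_apply_of_not_mem _ hs)

/-- A lift of a cycle commutes with every lift of an element of its centralizer. -/
theorem commute_of_isCycle (hπ : AltCover π) {x k : G} (hx : (π x).IsCycle)
    (hcard : (π x).support.card + 5 ≤ Fintype.card α) (hk : Commute (π k) (π x)) :
    Commute k x := by
  obtain ⟨a, ha, -⟩ := id hx
  have hka : π x (π k a) ≠ π k a := by
    rw [← Equiv.Perm.mul_apply, ← hk.eq, Equiv.Perm.mul_apply]
    exact fun h => ha ((π k).injective h)
  obtain ⟨i, hi⟩ := hx.exists_zpow_eq ha hka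
  have hfix : π (x ^ (-i) * k) a = a := by
    rw [map_mul, map_zpow, Equiv.Perm.mul_apply, ← hi, ← Equiv.Perm.mul_apply, ← zpow_add]
    simp
  have hcomm : Commute (π (x ^ (-i) * k)) (π x) := by
    rw [map_mul, map_zpow]
    exact ((Commute.refl _).zpow_left _).mul_left hk
  have h1 : Commute x (x ^ (-i) * k) := by
    refine hπ.commute_of_disjoint (S := (π x).supportᶜ) ?_ (fun s hs => ?_) (fun s hs => ?_)
    · rw [Finset.card_compl]
      omega
    · simpa using hs
    · have hs' : π x s ≠ s := by simpa using hs
      obtain ⟨j, rfl⟩ := hx.exists_zpow_eq ha hs'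
      rw [← Equiv.Perm.mul_apply, (hcomm.zpow_right j).eq, Equiv.Perm.mul_apply, hfix]
  have h2 : k = x ^ i * (x ^ (-i) * k) := by group
  rw [h2]
  exact ((Commute.refl x).zpow_left i).mul_left h1.symm

end AltCover

/-- The three-cycle sending `a` to `b`, `b` to `c` and `c` to `a`. -/
def threeCycle {α : Type*} [DecidableEq α] (a b c : α) : Equiv.Perm α :=
  Equiv.swap a c * Equiv.swap a b

section ThreeCycle

variable {α : Type*} [DecidableEq α]

theorem threeCycle_rotate {a b c : α} (hab : a ≠ b) (hac : a ≠ c) (hbc : b ≠ c) :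
    threeCycle a b c = threeCycle b c a := by
  ext x
  simp only [threeCycle, Equiv.Perm.mul_apply, Equiv.swap_apply_def]
  grind

theorem threeCycle_inv {a b c : α} : (threeCycle a b c)⁻¹ = threeCycle a c b := by
  simp [threeCycle]

theorem conj_threeCycle (g : Equiv.Perm α) (a b c : α) :
    g * threeCycle a b c * g⁻¹ = threeCycle (g a) (g b) (g c) := by
  simp only [threeCycle, Equiv.swap_apply_apply]
  group

theorem threeCycle_apply_left {a b c : α} (hab : a ≠ b) (hbc : b ≠ c) :
    threeCycle a b c a = b := by
  simp [threeCycle, Equiv.swap_apply_of_ne_of_ne hab.symm hbc]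

theorem threeCycle_apply_mid {a b c : α} : threeCycle a b c b = c := by
  simp [threeCycle]

theorem threeCycle_apply_right {a b c : α} (hac : a ≠ c) (hbc : b ≠ c) :
    threeCycle a b c c = a := by
  simp [threeCycle, Equiv.swap_apply_of_ne_of_ne hac.symm hbc.symm]

theorem threeCycle_apply_of_ne {a b c x : α} (ha : x ≠ a) (hb : x ≠ b) (hc : x ≠ c) :
    threeCycle a b c x = x := by
  simp [threeCycle, Equiv.swap_apply_of_ne_of_ne, *]

theorem threeCycle_mul_threeCycle {a b c d : α} (hab : a ≠ b) (had : a ≠ d)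
    (hbc : b ≠ c) (hbd : b ≠ d) (hcd : c ≠ d) :
    threeCycle a b c * threeCycle a b d = Equiv.swap a c * Equiv.swap b d := by
  ext x
  simp only [threeCycle, Equiv.Perm.mul_apply, Equiv.swap_apply_def]
  grind

theorem conj_swap_mul_swap (g : Equiv.Perm α) (a b c d : α) :
    g * (Equiv.swap a b * Equiv.swap c d) * g⁻¹ =
      Equiv.swap (g a) (g b) * Equiv.swap (g c) (g d) := by
  simp only [Equiv.swap_apply_apply]
  group

theorem swap_mul_swap_sq {a b c d : α} (hab : a ≠ b) (hac : a ≠ c) (had : a ≠ d)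
    (hbc : b ≠ c) (hbd : b ≠ d) (hcd : c ≠ d) : (Equiv.swap a c * Equiv.swap b d) ^ 2 = 1 := by
  ext x
  simp only [pow_two, Equiv.Perm.mul_apply, Equiv.swap_apply_def, Equiv.Perm.one_apply]
  grind

end ThreeCycle

/-- A lift of a three-cycle which has order three and is conjugate to its inverse. -/
structure GoodLift {α G : Type*} [Fintype α] [DecidableEq α] [Group G] (π : G →* Equiv.Perm α)
    (X : G) : Prop where
  isThreeCycle : (π X).IsThreeCycle
  pow_three : X ^ 3 = 1
  exists_conj : ∃ h, h * X * h⁻¹ = X⁻¹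

namespace GoodLift

variable {α G : Type*} [Fintype α] [DecidableEq α] [Group G] {π : G →* Equiv.Perm α}

theorem conj {X : G} (hX : GoodLift π X) (g : G) : GoodLift π (g * X * g⁻¹) := by
  obtain ⟨h, hh⟩ := hX.exists_conj
  refine ⟨?_, ?_, g * h * g⁻¹, ?_⟩
  · rw [Equiv.Perm.IsThreeCycle, map_mul, map_mul, map_inv, Equiv.Perm.cycleType_conj]
    exact hX.isThreeCycle
  · rw [conj_pow, hX.pow_three, mul_one, mul_inv_cancel]
  · calc g * h * g⁻¹ * (g * X * g⁻¹) * (g * h * g⁻¹)⁻¹ = g * (h * X * h⁻¹) * g⁻¹ := by group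
      _ = (g * X * g⁻¹)⁻¹ := by rw [hh]; group

theorem inv {X : G} (hX : GoodLift π X) : GoodLift π X⁻¹ := by
  obtain ⟨h, hh⟩ := hX.exists_conj
  refine ⟨?_, ?_, h, ?_⟩
  · rw [map_inv]
    exact hX.isThreeCycle.inv
  · rw [inv_pow, hX.pow_three, inv_one]
  · rw [← conj_inv, hh]

theorem eq_of_map_eq (hπ : AltCover π) (hα : 8 ≤ Fintype.card α) {X Y : G} (hX : GoodLift π X)
    (hY : GoodLift π Y) (h : π X = π Y) : X = Y := by
  obtain ⟨z, rfl, hz⟩ := hπ.exists_central h.symm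
  have hzc : ∀ g, Commute z g := hz
  have hz3 : z ^ 3 = 1 := by
    have := hY.pow_three
    rwa [(hzc X).symm.mul_pow, hX.pow_three, one_mul] at this
  obtain ⟨u, hu⟩ := hX.exists_conj
  obtain ⟨v, hv⟩ := hY.exists_conj
  have hv' : v * X * v⁻¹ = X⁻¹ * (z⁻¹ * z⁻¹) := by
    have h1 : v * (X * z) * v⁻¹ = v * X * v⁻¹ * z := by
      rw [← mul_assoc, mul_assoc _ z, hz, ← mul_assoc]
    rw [h1] at hv
    rw [← mul_inv_cancel_right (v * X * v⁻¹) z, hv, mul_inv_rev, ← ((hzc X).inv_inv).eq.symm]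
    group
  have hk : u⁻¹ * v * X * (u⁻¹ * v)⁻¹ = X * (z⁻¹ * z⁻¹) := by
    calc u⁻¹ * v * X * (u⁻¹ * v)⁻¹ = u⁻¹ * (v * X * v⁻¹) * u := by group
      _ = u⁻¹ * X⁻¹ * ((z⁻¹ * z⁻¹) * u) := by rw [hv']; group
      _ = u⁻¹ * X⁻¹ * (u * (z⁻¹ * z⁻¹)) := by
        rw [((hzc u).inv_left.mul_left (hzc u).inv_left).eq]
      _ = u⁻¹ * (u * X * u⁻¹) * u * (z⁻¹ * z⁻¹) := by rw [hu]; group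
      _ = X * (z⁻¹ * z⁻¹) := by group
  have hπz : π z = 1 := by simpa using h
  have hcomm : Commute (u⁻¹ * v) X := by
    refine hπ.commute_of_isCycle hX.isThreeCycle.isCycle ?_ ?_
    · rw [hX.isThreeCycle.card_support]
      exact hα
    · have := congrArg π hk
      simp only [map_mul, map_inv, hπz, inv_one, mul_one] at this
      rw [map_mul, map_inv]
      exact mul_inv_eq_iff_eq_mul.1 (by simpa [mul_assoc] using this)
  rw [hcomm.eq, mul_inv_cancel_right] at hk
  have hz2 : z * z = 1 := by
    have h1 : z⁻¹ * z⁻¹ = 1 := by simpa using hk.symm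
    rw [← inv_inj, mul_inv_rev, h1, inv_one]
  have hz1 : z = 1 := by
    rw [pow_succ, pow_two, hz2, one_mul] at hz3
    exact hz3
  rw [hz1, mul_one]

theorem exists_map_eq (hπ : AltCover π) (hα : 8 ≤ Fintype.card α) {σ : Equiv.Perm α}
    (hσ : σ.IsThreeCycle) : ∃ X, GoodLift π X ∧ π X = σ := by
  obtain ⟨X, hX⟩ := hπ.exists_lift hσ.sign
  have hconj : IsConj (⟨σ, hσ.mem_alternatingGroup⟩ : alternatingGroup α)
      ⟨σ⁻¹, hσ.inv.mem_alternatingGroup⟩ :=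
    alternatingGroup.isThreeCycle_isConj (by rw [Nat.card_eq_fintype_card]; omega) hσ hσ.inv
  obtain ⟨c, hc⟩ := isConj_iff.1 hconj
  obtain ⟨h, hh⟩ := hπ.exists_lift c.2
  have hc' : (c : Equiv.Perm α) * σ * (c : Equiv.Perm α)⁻¹ = σ⁻¹ := congrArg Subtype.val hc
  obtain ⟨z, hz, hzc⟩ := hπ.exists_central (a := h * X * h⁻¹) (b := X⁻¹) (by
    rw [map_mul, map_mul, map_inv, map_inv, hh, hX, hc'])
  have hzc : ∀ g, Commute z g := hzc
  have hσ3 : σ ^ 3 = 1 := by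
    rw [← hσ.orderOf]
    exact pow_orderOf_eq_one σ
  have hX3 : ∀ g, Commute (X ^ 3) g := hπ.central _ (by rw [map_pow, hX, hσ3])
  have hXz : (X ^ 3)⁻¹ * z ^ 3 = X ^ 3 := by
    calc (X ^ 3)⁻¹ * z ^ 3 = (X⁻¹ * z) ^ 3 := by
          rw [(hzc X⁻¹).symm.mul_pow, inv_pow]
      _ = h * X ^ 3 * h⁻¹ := by rw [← hz, conj_pow]
      _ = X ^ 3 := by rw [← (hX3 h).eq, mul_inv_cancel_right]
  have hπz : π z = 1 := by
    have := congrArg π hz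
    rw [map_mul, map_mul, map_mul, map_inv, map_inv, hh, hX, hc'] at this
    simpa using this
  have hπt : π (X⁻¹ ^ 2 * z) = σ := by
    rw [map_mul, hπz, mul_one, map_pow, map_inv, hX, inv_pow, inv_eq_iff_mul_eq_one, ← pow_succ,
      hσ3]
  refine ⟨X⁻¹ ^ 2 * z, ⟨hπt.symm ▸ hσ, ?_, h, ?_⟩, hπt⟩
  · rw [(hzc _).symm.mul_pow, ← pow_mul, inv_pow, mul_comm 2 3, pow_mul, pow_two, mul_inv_rev,
      mul_assoc, hXz, inv_mul_cancel]
  · calc h * (X⁻¹ ^ 2 * z) * h⁻¹ = h * X⁻¹ ^ 2 * (z * h⁻¹) := by group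
      _ = h * X⁻¹ ^ 2 * (h⁻¹ * z) := by rw [(hzc _).eq]
      _ = (h * X * h⁻¹)⁻¹ * (h * X * h⁻¹)⁻¹ * z := by group
      _ = (z⁻¹ * X) ^ 2 * z := by rw [hz, mul_inv_rev, inv_inv, pow_two]
      _ = z⁻¹ * z⁻¹ * X ^ 2 * z := by rw [((hzc X).inv_left).mul_pow, pow_two z⁻¹]
      _ = z⁻¹ * (z⁻¹ * (X ^ 2 * z)) := by group
      _ = (X⁻¹ ^ 2 * z)⁻¹ := by
        rw [← (hzc (X ^ 2)).eq]; group

end GoodLift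

section

variable {α G : Type*} [Fintype α] [DecidableEq α] [Group G] {π : G →* Equiv.Perm α}

/-- The good lift of `threeCycle a b c`. -/
noncomputable def goodLift (π : G →* Equiv.Perm α) (a b c : α) : G :=
  Classical.epsilon fun X => GoodLift π X ∧ π X = threeCycle a b c

theorem isThreeCycle_threeCycle {a b c : α} (hab : a ≠ b) (hac : a ≠ c) (hbc : b ≠ c) :
    (threeCycle a b c).IsThreeCycle :=
  Equiv.Perm.isThreeCycle_swap_mul_swap_same hac hab hbc.symm

namespace AltCover

theorem goodLift_spec (hπ : AltCover π) (hα : 8 ≤ Fintype.card α) {a b c : α} (hab : a ≠ b)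
    (hac : a ≠ c) (hbc : b ≠ c) :
    GoodLift π (goodLift π a b c) ∧ π (goodLift π a b c) = threeCycle a b c :=
  Classical.epsilon_spec
    (GoodLift.exists_map_eq hπ hα (isThreeCycle_threeCycle hab hac hbc))

theorem eq_goodLift (hπ : AltCover π) (hα : 8 ≤ Fintype.card α) {a b c : α} (hab : a ≠ b)
    (hac : a ≠ c) (hbc : b ≠ c) {X : G} (hX : GoodLift π X) (h : π X = threeCycle a b c) :
    X = goodLift π a b c :=
  hX.eq_of_map_eq hπ hα (hπ.goodLift_spec hα hab hac hbc).1
    (h.trans (hπ.goodLift_spec hα hab hac hbc).2.symm)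

theorem goodLift_rotate (hπ : AltCover π) (hα : 8 ≤ Fintype.card α) {a b c : α} (hab : a ≠ b)
    (hac : a ≠ c) (hbc : b ≠ c) : goodLift π a b c = goodLift π b c a :=
  hπ.eq_goodLift hα hbc hab.symm hac.symm (hπ.goodLift_spec hα hab hac hbc).1
    ((hπ.goodLift_spec hα hab hac hbc).2.trans (threeCycle_rotate hab hac hbc))

theorem goodLift_inv (hπ : AltCover π) (hα : 8 ≤ Fintype.card α) {a b c : α} (hab : a ≠ b)
    (hac : a ≠ c) (hbc : b ≠ c) : (goodLift π a b c)⁻¹ = goodLift π a c b :=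
  hπ.eq_goodLift hα hac hab hbc.symm (hπ.goodLift_spec hα hab hac hbc).1.inv
    (by rw [map_inv, (hπ.goodLift_spec hα hab hac hbc).2, threeCycle_inv])

theorem conj_goodLift (hπ : AltCover π) (hα : 8 ≤ Fintype.card α) {a b c : α} (hab : a ≠ b)
    (hac : a ≠ c) (hbc : b ≠ c) (g : G) :
    g * goodLift π a b c * g⁻¹ = goodLift π (π g a) (π g b) (π g c) :=
  hπ.eq_goodLift hα ((π g).injective.ne hab) ((π g).injective.ne hac) ((π g).injective.ne hbc)
    ((hπ.goodLift_spec hα hab hac hbc).1.conj g)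
    (by rw [map_mul, map_mul, map_inv, (hπ.goodLift_spec hα hab hac hbc).2, conj_threeCycle])

/-- The double transpositions of each four-point set have commuting lifts. -/
def CommutingKleinLifts (π : G →* Equiv.Perm α) : Prop :=
  ∀ a b c d : α, a ≠ b → a ≠ c → a ≠ d → b ≠ c → b ≠ d → c ≠ d → ∀ v w : G,
    π v = Equiv.swap a b * Equiv.swap c d → π w = Equiv.swap a c * Equiv.swap b d → Commute v w

theorem goodLift_mul_goodLift_sq (hπ : AltCover π) (hα : 8 ≤ Fintype.card α)
    (hV : CommutingKleinLifts π) {a b c d : α} (hab : a ≠ b) (hac : a ≠ c) (had : a ≠ d)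
    (hbc : b ≠ c) (hbd : b ≠ d) (hcd : c ≠ d) :
    (goodLift π a b c * goodLift π a b d) ^ 2 = 1 := by
  have hX := hπ.goodLift_spec hα hab hac hbc
  have hY := hπ.goodLift_spec hα hab had hbd
  have hconjX := hπ.conj_goodLift hα hab hac hbc
  have hconjY := hπ.conj_goodLift hα hab had hbd
  have hXi : (goodLift π a b c)⁻¹ = goodLift π b a c := by
    rw [hπ.goodLift_inv hα hab hac hbc, hπ.goodLift_rotate hα hac hab hbc.symm,
      hπ.goodLift_rotate hα hbc.symm hac.symm hab.symm]
  have hYi : (goodLift π a b d)⁻¹ = goodLift π b a d := by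
    rw [hπ.goodLift_inv hα hab had hbd, hπ.goodLift_rotate hα had hab hbd.symm,
      hπ.goodLift_rotate hα hbd.symm had.symm hab.symm]
  have hk : ∃ k, π k = Equiv.swap a b * Equiv.swap c d :=
    hπ.exists_lift (by simp [hab, hcd])
  obtain ⟨k, hk⟩ := hk
  have hka : π k a = b := by
    simp [hk, Equiv.swap_apply_of_ne_of_ne hac had]
  have hkb : π k b = a := by
    simp [hk, Equiv.swap_apply_of_ne_of_ne hbc hbd]
  have hkc : π k c = d := by
    simp [hk, Equiv.swap_apply_of_ne_of_ne had.symm hbd.symm]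
  have hkd : π k d = c := by
    simp [hk, Equiv.swap_apply_of_ne_of_ne hac.symm hbc.symm]
  have hkX := hconjX k
  have hkY := hconjY k
  rw [hka, hkb, hkc, ← hYi] at hkX
  rw [hka, hkb, hkd, ← hXi] at hkY
  have hXv := threeCycle_mul_threeCycle hab had hbc hbd hcd
  rw [← hX.2, ← hY.2, ← map_mul] at hXv
  have hXa : π (goodLift π a b c) a = b := by rw [hX.2, threeCycle_apply_left hab hbc]
  have hXb : π (goodLift π a b c) b = c := by rw [hX.2, threeCycle_apply_mid]
  have hXc : π (goodLift π a b c) c = a := by rw [hX.2, threeCycle_apply_right hac hbc]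
  have hXd : π (goodLift π a b c) d = d := by
    rw [hX.2, threeCycle_apply_of_ne had.symm hbd.symm hcd.symm]
  have hX3 := hX.1.pow_three
  have hY3 := hY.1.pow_three
  generalize goodLift π a b c = X at *
  generalize goodLift π a b d = Y at *
  clear hconjX hconjY hXi hYi hX hY
  obtain ⟨v, hv⟩ : ∃ v, v = X * Y := ⟨_, rfl⟩
  rw [← hv] at hXv ⊢
  have hX2 : X * X = X⁻¹ := by
    rw [eq_inv_iff_mul_eq_one, ← pow_three', hX3]
  have hv2 : π (X * v * X⁻¹) = Equiv.swap b a * Equiv.swap c d := by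
    rw [map_mul, map_mul, map_inv, hXv, conj_swap_mul_swap, hXa, hXb, hXc, hXd]
  have hv1 : π (X⁻¹ * v * X) = Equiv.swap b c * Equiv.swap a d := by
    have h := conj_swap_mul_swap (π X)⁻¹ a c b d
    rw [Equiv.Perm.inv_eq_iff_eq.2 hXa.symm, Equiv.Perm.inv_eq_iff_eq.2 hXb.symm,
      Equiv.Perm.inv_eq_iff_eq.2 hXc.symm, Equiv.Perm.inv_eq_iff_eq.2 hXd.symm, inv_inv,
      Equiv.swap_comm c b] at h
    rw [map_mul, map_mul, map_inv, hXv, h]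
  have hc10 : Commute (X⁻¹ * v * X) v :=
    hV c b a d hbc.symm hac.symm hcd hab.symm hbd had _ _ (by rw [hv1, Equiv.swap_comm b c])
      (by rw [hXv, Equiv.swap_comm a c])
  have hc20 : Commute (X * v * X⁻¹) v :=
    hV a b c d hab hac had hbc hbd hcd _ _ (by rw [hv2, Equiv.swap_comm b a]) hXv
  have hc21 : Commute (X * v * X⁻¹) (X⁻¹ * v * X) :=
    hV b a c d hab.symm hbc hbd hac had hcd _ _ hv2 hv1
  have hvv : ∀ g, Commute (v ^ 2) g := hπ.central _ (by
    rw [map_pow, hXv, swap_mul_swap_sq hab hac had hbc hbd hcd])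
  have hprod : X⁻¹ * v * X * (X * v * X⁻¹) * v = 1 := by
    calc X⁻¹ * v * X * (X * v * X⁻¹) * v = X⁻¹ * v * (X * X) * v * X⁻¹ * v := by group
      _ = Y ^ 3 := by rw [hX2, hv, pow_three']; group
      _ = 1 := hY3
  have hs1 : (X⁻¹ * v * X) ^ 2 = v ^ 2 := by
    have := conj_pow (i := 2) (a := X⁻¹) (b := v)
    rw [inv_inv] at this
    rw [this, ← ((hvv X⁻¹).eq), inv_mul_cancel_right]
  have hs2 : (X * v * X⁻¹) ^ 2 = v ^ 2 := by
    rw [conj_pow, ← ((hvv X).eq), mul_inv_cancel_right]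
  have h3 : v ^ 2 * v ^ 2 * v ^ 2 = 1 := by
    have := congrArg (· ^ 2) hprod
    simp only [one_pow] at this
    rwa [(hc10.mul_left hc20).mul_pow, hc21.symm.mul_pow, hs1, hs2] at this
  have h2 : v ^ 2 * v ^ 2 = 1 := by
    have h : k * v * k⁻¹ = v⁻¹ := by
      calc k * v * k⁻¹ = k * X * k⁻¹ * (k * Y * k⁻¹) := by rw [hv]; group
        _ = v⁻¹ := by rw [hkX, hkY, hv, mul_inv_rev]
    have h' := congrArg (· ^ 2) h
    simp only [conj_pow, ← ((hvv k).eq), mul_inv_cancel_right, inv_pow] at h'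
    exact mul_eq_one_iff_eq_inv.2 h'
  rwa [h2, one_mul] at h3

end AltCover

end

section

variable {α G : Type*} [Fintype α] [DecidableEq α] [Group G] {π : G →* Equiv.Perm α}

theorem Equiv.Perm.IsThreeCycle.exists_eq_threeCycle {σ : Equiv.Perm α} (hσ : σ.IsThreeCycle) :
    ∃ a b c, a ≠ b ∧ a ≠ c ∧ b ≠ c ∧ σ = threeCycle a b c := by
  obtain ⟨a, ha⟩ : σ.support.Nonempty := by
    rw [← Finset.card_pos, hσ.card_support]
    norm_num
  have hnd := hσ.nodup_iff_mem_support.2 ha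
  have heq := hσ.eq_swap_mul_swap_iff_mem_support.2 ha
  generalize σ a = b at *
  generalize σ b = c at *
  simp only [List.nodup_cons, List.mem_cons, List.not_mem_nil, or_false, not_or] at hnd
  refine ⟨a, b, c, hnd.1.1, hnd.1.2, hnd.2.1, ?_⟩
  rw [threeCycle_rotate hnd.1.1 hnd.1.2 hnd.2.1, heq, threeCycle, Equiv.swap_comm b a]

/-- The subgroup generated by the good lifts of the three-cycles on `S`. -/
def goodClosure (π : G →* Equiv.Perm α) (S : Set α) : Subgroup G :=
  Subgroup.closure
    {X | ∃ a ∈ S, ∃ b ∈ S, ∃ c ∈ S, a ≠ b ∧ a ≠ c ∧ b ≠ c ∧ X = goodLift π a b c}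

namespace AltCover

theorem goodLift_mem_goodClosure {S : Set α} {a b c : α} (ha : a ∈ S) (hb : b ∈ S) (hc : c ∈ S)
    (hab : a ≠ b) (hac : a ≠ c) (hbc : b ≠ c) : goodLift π a b c ∈ goodClosure π S :=
  Subgroup.subset_closure ⟨a, ha, b, hb, c, hc, hab, hac, hbc, rfl⟩

theorem apply_eq_of_mem_goodClosure (hπ : AltCover π) (hα : 8 ≤ Fintype.card α) {S : Set α}
    {x : G} (hx : x ∈ goodClosure π S) {s : α} (hs : s ∉ S) : π x s = s := by
  have hle : goodClosure π S ≤ (MulAction.stabilizer (Equiv.Perm α) s).comap π := by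
    rw [goodClosure, Subgroup.closure_le]
    rintro _ ⟨a, ha, b, hb, c, hc, hab, hac, hbc, rfl⟩
    rw [SetLike.mem_coe, Subgroup.mem_comap, MulAction.mem_stabilizer_iff, Equiv.Perm.smul_def,
      (hπ.goodLift_spec hα hab hac hbc).2, threeCycle_apply_of_ne] <;>
    · rintro rfl
      exact hs ‹_›
  exact hle hx

theorem apply_mem_of_mem_goodClosure (hπ : AltCover π) (hα : 8 ≤ Fintype.card α) {S : Set α}
    {x : G} (hx : x ∈ goodClosure π S) {s : α} (hs : s ∈ S) : π x s ∈ S := by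
  by_contra hn
  have h := (π x).injective (hπ.apply_eq_of_mem_goodClosure hα hx hn)
  exact hn (h.symm ▸ hs)

variable {a b c d : α}

theorem inv_goodLift_mul_goodLift (hπ : AltCover π) (hα : 8 ≤ Fintype.card α)
    (hV : CommutingKleinLifts π) (hab : a ≠ b) (hac : a ≠ c) (had : a ≠ d) (hbc : b ≠ c)
    (hbd : b ≠ d) (hcd : c ≠ d) :
    (goodLift π a b c)⁻¹ * goodLift π a b d = goodLift π b d c := by
  have hp := hπ.goodLift_mul_goodLift_sq hα hV hab hac had hbc hbd hcd
  have hX := hπ.goodLift_spec hα hab hac hbc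
  have h := hπ.conj_goodLift hα hab had hbd (goodLift π a b c)
  rw [hX.2, threeCycle_apply_left hab hbc, threeCycle_apply_mid,
    threeCycle_apply_of_ne had.symm hbd.symm hcd.symm] at h
  have h3 := hX.1.pow_three
  rw [← inv_inj, hπ.goodLift_inv hα hbd hbc hcd.symm, ← h]
  generalize goodLift π a b c = X at *
  generalize goodLift π a b d = Y at *
  have hX2 : X⁻¹ = X * X := by
    rw [inv_eq_iff_mul_eq_one, ← pow_three, h3]
  have hY : X * Y * X = Y⁻¹ := by
    rw [eq_inv_iff_mul_eq_one, mul_assoc, ← pow_two, hp]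
  rw [mul_inv_rev, inv_inv, ← hY, hX2, mul_assoc]

/-- One step of the normal form computation in `goodClosure π (insert p S)`. -/
theorem goodLift_mul_mem (hπ : AltCover π) (hα : 8 ≤ Fintype.card α)
    (hV : CommutingKleinLifts π) {S : Set α} {p : α} (hp : p ∉ S) (ha : a ∈ S) (hb : b ∈ S)
    (hab : a ≠ b) {y : G}
    (hy : y ∈ goodClosure π S ∨
      ∃ i ∈ S, ∃ j ∈ S, i ≠ j ∧ ∃ k ∈ goodClosure π S, y = goodLift π p i j * k) :
    goodLift π p a b * y ∈ goodClosure π S ∨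
      ∃ i ∈ S, ∃ j ∈ S, i ≠ j ∧
        ∃ k ∈ goodClosure π S, goodLift π p a b * y = goodLift π p i j * k := by
  have hne : ∀ {i}, i ∈ S → p ≠ i := fun hi h => hp (h ▸ hi)
  have hpa := hne ha
  have hpb := hne hb
  rcases hy with hy | ⟨i, hi, j, hj, hij, k, hk, rfl⟩
  · exact Or.inr ⟨a, ha, b, hb, hab, y, hy, rfl⟩
  have hpi := hne hi
  have hpj := hne hj
  by_cases hib : i = b
  · subst hib
    left
    by_cases hja : j = a
    · subst hja
      rwa [← hπ.goodLift_inv hα hpa hpb hab, mul_inv_cancel_left]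
    · have h := hπ.inv_goodLift_mul_goodLift hα hV hpi hpa hpj (Ne.symm hab) hij (Ne.symm hja)
      rw [hπ.goodLift_inv hα hpi hpa hab.symm] at h
      rw [← mul_assoc, h]
      exact mul_mem (goodLift_mem_goodClosure hi hj ha hij hab.symm hja) hk
  right
  by_cases hia : i = a
  · subst hia
    have hsq : goodLift π p i b * goodLift π p i b = goodLift π p b i := by
      rw [← hπ.goodLift_inv hα hpi hpb hab, eq_inv_iff_mul_eq_one, ← pow_three',
        (hπ.goodLift_spec hα hpi hpb hab).1.pow_three]
    by_cases hjb : j = b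
    · subst hjb
      exact ⟨j, hj, i, hi, hab.symm, k, hk, by rw [← mul_assoc, hsq]⟩
    · have h := hπ.inv_goodLift_mul_goodLift hα hV hpi hpb hpj hab hij (Ne.symm hjb)
      rw [inv_mul_eq_iff_eq_mul] at h
      refine ⟨b, hb, i, hi, hab.symm, goodLift π i j b * k,
        mul_mem (goodLift_mem_goodClosure hi hj hb hij hab hjb) hk, ?_⟩
      rw [h, ← hsq]
      simp only [mul_assoc]
  have h1 : goodLift π p a b * goodLift π p i a = goodLift π p i a * goodLift π a i b := by
    have h := hπ.conj_goodLift hα hpa hpb hab (goodLift π p a i)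
    rw [(hπ.goodLift_spec hα hpa hpi (Ne.symm hia)).2, threeCycle_apply_left hpa (Ne.symm hia),
      threeCycle_apply_mid, threeCycle_apply_of_ne hpb.symm hab.symm (Ne.symm hib),
      ← hπ.goodLift_inv hα hpi hpa hia, inv_inv, mul_assoc, inv_mul_eq_iff_eq_mul] at h
    exact h
  by_cases hja : j = a
  · subst hja
    exact ⟨i, hi, j, hj, hij, goodLift π j i b * k,
      mul_mem (goodLift_mem_goodClosure hj hi hb hij.symm hab hib) hk, by
        rw [← mul_assoc, h1, mul_assoc]⟩
  · have h2 := hπ.inv_goodLift_mul_goodLift hα hV hpi hpa hpj hia hij (Ne.symm hja)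
    rw [inv_mul_eq_iff_eq_mul] at h2
    refine ⟨i, hi, a, ha, hia, goodLift π a i b * (goodLift π i j a * k),
      mul_mem (goodLift_mem_goodClosure ha hi hb (Ne.symm hia) hab hib)
        (mul_mem (goodLift_mem_goodClosure hi hj ha hij hia hja) hk), ?_⟩
    rw [h2, ← mul_assoc, ← mul_assoc, h1]
    simp only [mul_assoc]

theorem goodClosure_insert (hπ : AltCover π) (hα : 8 ≤ Fintype.card α)
    (hV : CommutingKleinLifts π) {S : Set α} {p : α} (hp : p ∉ S) {y : G}
    (hy : y ∈ goodClosure π (insert p S)) :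
    y ∈ goodClosure π S ∨
      ∃ i ∈ S, ∃ j ∈ S, i ≠ j ∧ ∃ k ∈ goodClosure π S, y = goodLift π p i j * k := by
  have hne : ∀ {i}, i ∈ S → i ≠ p := fun hi h => hp (h ▸ hi)
  have key : ∀ a ∈ insert p S, ∀ b ∈ insert p S, ∀ c ∈ insert p S, a ≠ b → a ≠ c → b ≠ c → ∀ y,
      (y ∈ goodClosure π S ∨
        ∃ i ∈ S, ∃ j ∈ S, i ≠ j ∧ ∃ k ∈ goodClosure π S, y = goodLift π p i j * k) →
      (goodLift π a b c * y ∈ goodClosure π S ∨ ∃ i ∈ S, ∃ j ∈ S, i ≠ j ∧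
        ∃ k ∈ goodClosure π S, goodLift π a b c * y = goodLift π p i j * k) := by
    intro a ha b hb c hc hab hac hbc y hy
    rcases ha with rfl | ha
    · exact hπ.goodLift_mul_mem hα hV hp (hb.resolve_left hab.symm) (hc.resolve_left hac.symm)
        hbc hy
    rcases hb with rfl | hb
    · rw [hπ.goodLift_rotate hα hab hac hbc]
      exact hπ.goodLift_mul_mem hα hV hp (hc.resolve_left hbc.symm) ha hac.symm hy
    rcases hc with rfl | hc
    · rw [← hπ.goodLift_rotate hα hac.symm hbc.symm hab]
      exact hπ.goodLift_mul_mem hα hV hp ha hb hab hy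
    have hx := goodLift_mem_goodClosure (π := π) ha hb hc hab hac hbc
    rcases hy with hy | ⟨i, hi, j, hj, hij, k, hk, rfl⟩
    · exact Or.inl (mul_mem hx hy)
    · have h := hπ.conj_goodLift hα (hne hi).symm (hne hj).symm hij (goodLift π a b c)
      rw [hπ.apply_eq_of_mem_goodClosure hα hx hp, mul_inv_eq_iff_eq_mul] at h
      refine Or.inr ⟨_, hπ.apply_mem_of_mem_goodClosure hα hx hi, _,
        hπ.apply_mem_of_mem_goodClosure hα hx hj, (Equiv.injective _).ne hij, _,
        mul_mem hx hk, ?_⟩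
      rw [← mul_assoc, h, mul_assoc]
  induction hy using Subgroup.closure_induction_left with
  | one => exact Or.inl (one_mem _)
  | mul_left x hx y hy ih =>
    obtain ⟨a, ha, b, hb, c, hc, hab, hac, hbc, rfl⟩ := hx
    exact key a ha b hb c hc hab hac hbc y ih
  | inv_mul_cancel x hx y hy ih =>
    obtain ⟨a, ha, b, hb, c, hc, hab, hac, hbc, rfl⟩ := hx
    rw [hπ.goodLift_inv hα hab hac hbc]
    exact key a ha c hc b hb hac hab hbc.symm y ih

theorem eq_one_of_mem_goodClosure (hπ : AltCover π) (hα : 8 ≤ Fintype.card α)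
    (hV : CommutingKleinLifts π) (S : Finset α) {x : G} (hx : x ∈ goodClosure π (S : Set α))
    (h : π x = 1) : x = 1 := by
  induction S using Finset.induction_on with
  | empty => simpa [goodClosure] using hx
  | insert p S hp ih =>
    rw [Finset.coe_insert] at hx
    have hp' : p ∉ (S : Set α) := by simpa using hp
    rcases hπ.goodClosure_insert hα hV hp' hx with hx | ⟨i, hi, j, hj, hij, k, hk, rfl⟩
    · exact ih hx
    · have hpi : p ≠ i := fun h => hp' (h ▸ hi)
      have hpj : p ≠ j := fun h => hp' (h ▸ hj)
      have h1 := Equiv.congr_fun h p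
      rw [map_mul, Equiv.Perm.mul_apply, hπ.apply_eq_of_mem_goodClosure hα hk hp',
        (hπ.goodLift_spec hα hpi hpj hij).2, threeCycle_apply_left hpi hij,
        Equiv.Perm.one_apply] at h1
      exact absurd h1.symm hpi

theorem goodClosure_univ (hπ : AltCover π) (hα : 8 ≤ Fintype.card α) :
    goodClosure π Set.univ = ⊤ := by
  have hmap : alternatingGroup α ≤ (goodClosure π Set.univ).map π := by
    rw [← Equiv.Perm.closure_three_cycles_eq_alternating, Subgroup.closure_le]
    intro σ hσ
    obtain ⟨a, b, c, hab, hac, hbc, rfl⟩ := Equiv.Perm.IsThreeCycle.exists_eq_threeCycle hσ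
    exact ⟨goodLift π a b c, goodLift_mem_goodClosure trivial trivial trivial hab hac hbc,
      (hπ.goodLift_spec hα hab hac hbc).2⟩
  rw [eq_top_iff, ← hπ.perfect, commutator_def, Subgroup.commutator_le]
  intro g _ h _
  obtain ⟨g', hg', hg⟩ := hmap (hπ.range_eq ▸ ⟨g, rfl⟩ : π g ∈ alternatingGroup α)
  obtain ⟨h', hh', hh⟩ := hmap (hπ.range_eq ▸ ⟨h, rfl⟩ : π h ∈ alternatingGroup α)
  rw [hπ.commutator_congr hg.symm hh.symm]
  exact mul_mem (mul_mem (mul_mem hg' hh') (inv_mem hg')) (inv_mem hh')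

/-- If the lifts of the Klein four-groups are commutative then the cover is trivial. -/
theorem injective_of_commutingKleinLifts (hπ : AltCover π) (hα : 8 ≤ Fintype.card α)
    (hV : CommutingKleinLifts π) : Function.Injective π := by
  rw [injective_iff_map_eq_one]
  intro x hx
  refine hπ.eq_one_of_mem_goodClosure hα hV Finset.univ ?_ hx
  rw [Finset.coe_univ, hπ.goodClosure_univ hα]
  trivial

end AltCover

end

section Blocks

open Equiv

/-- A permutation with at least two cycles of length `k + 1` acts on two disjoint blocks
as a rotation. -/
theorem exists_embedding_finRotate {α : Type*} [Fintype α] [DecidableEq α] {σ : Perm α} {m k : ℕ}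
    (hm : 2 ≤ m) (hσ : σ.cycleType = Multiset.replicate m (k + 1)) :
    ∃ f : Bool × Fin (k + 1) ↪ α, ∀ b i, σ (f (b, i)) = f (b, finRotate (k + 1) i) := by
  have hcard : 1 < σ.cycleFactorsFinset.card := by
    have h := congrArg Multiset.card hσ
    rw [Perm.cycleType_def, Multiset.card_map, Multiset.card_replicate] at h
    have h' : σ.cycleFactorsFinset.card = m := h
    omega
  have hsupp : ∀ c ∈ σ.cycleFactorsFinset, c.support.card = k + 1 := fun c hc => by
    have h : c.support.card ∈ σ.cycleType := by
      rw [Perm.cycleType_def]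
      exact Multiset.mem_map.2 ⟨c, hc, rfl⟩
    rw [hσ] at h
    exact Multiset.eq_of_mem_replicate h
  obtain ⟨c₀, h₀, c₁, h₁, hne⟩ := Finset.one_lt_card.1 hcard
  let c : Bool → Perm α := fun b => cond b c₁ c₀
  have hc : ∀ b, c b ∈ σ.cycleFactorsFinset := fun b => by cases b <;> assumption
  have hinj : Function.Injective c := by
    intro b b' h
    cases b <;> cases b'
    · rfl
    · exact absurd h hne
    · exact absurd h hne.symm
    · rfl
  have hon : ∀ b, σ.IsCycleOn ((c b).support : Set α) := fun b =>
    Perm.isCycleOn_support_of_mem_cycleFactorsFinset (hc b)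
  have ha : ∀ b, ∃ a, a ∈ (c b).support := fun b =>
    (Perm.mem_cycleFactorsFinset_iff.1 (hc b)).1.nonempty_support
  choose a ha using ha
  have hmem : ∀ b (i : ℕ), (σ ^ i) (a b) ∈ (c b).support := fun b i => by
    induction i with
    | zero => exact ha b
    | succ i ih =>
      rw [pow_succ', Perm.mul_apply]
      exact (hon b).apply_mem_iff.2 ih
  refine ⟨⟨fun p => (σ ^ (p.2 : ℕ)) (a p.1), ?_⟩, fun b i => ?_⟩
  · rintro ⟨b, i⟩ ⟨b', j⟩ (h : (σ ^ (i : ℕ)) (a b) = (σ ^ (j : ℕ)) (a b'))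
    have hbb : b = b' := by
      by_contra hn
      have hd := (Perm.cycleFactorsFinset_pairwise_disjoint σ (hc b) (hc b') (hinj.ne hn))
      have := Finset.disjoint_left.1 hd.disjoint_support (hmem b i)
      exact this (h ▸ hmem b' j)
    subst hbb
    rw [(hon b).pow_apply_eq_pow_apply (ha b), hsupp _ (hc b)] at h
    rw [Fin.ext (h.eq_of_lt_of_lt i.2 j.2)]
  · change σ ((σ ^ (i : ℕ)) (a b)) = (σ ^ ((finRotate (k + 1) i : Fin (k + 1)) : ℕ)) (a b)
    rw [← Perm.mul_apply, ← pow_succ', (hon b).pow_apply_eq_pow_apply (ha b), hsupp _ (hc b),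
      finRotate_apply, Fin.val_add, Fin.val_one', Nat.add_mod_mod]
    exact (Nat.mod_modEq _ _).symm

variable {α ι : Type*} [Fintype α] [DecidableEq α] [Fintype ι] [DecidableEq ι]

theorem sign_viaEmbedding (e : Perm ι) (f : ι ↪ α) :
    Perm.sign (e.viaEmbedding f) = Perm.sign e := by
  classical
  rw [Perm.viaEmbedding, Perm.sign_extendDomain]

/-- The diagonal action of `Perm ι` on two copies of `ι`. -/
def diagonalPerm (ι : Type*) : Perm ι →* Perm (Bool × ι) :=
  MonoidHom.mk' (fun e => prodCongrRight fun _ => e) fun _ _ => by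
    ext ⟨b, i⟩ <;> rfl

/-- The exchange of the two copies of `ι`. -/
def flipPerm (ι : Type*) : Perm (Bool × ι) :=
  prodCongrLeft fun _ => swap false true

theorem sign_diagonalPerm (e : Perm ι) : Perm.sign (diagonalPerm ι e) = 1 := by
  change Perm.sign (prodCongrRight fun _ : Bool => e) = 1
  rw [Perm.sign_prodCongrRight, Fintype.prod_bool, ← Int.units_mul_self (Perm.sign e)]

theorem sign_flipPerm (h : Even (Fintype.card ι)) : Perm.sign (flipPerm ι) = 1 := by
  rw [flipPerm, Perm.sign_prodCongrLeft, Finset.prod_const, Perm.sign_swap (by decide),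
    Finset.card_univ, h.neg_one_pow]

theorem commute_flipPerm {ι : Type*} (e : Perm ι) : Commute (flipPerm ι) (diagonalPerm ι e) := by
  ext ⟨b, i⟩ <;> rfl

theorem swap_mul_swap_apply {α ι : Type*} [DecidableEq α] [DecidableEq ι] (f : Bool × ι ↪ α)
    {i₀ i₁ : ι} (h : i₀ ≠ i₁) (b : Bool) (i : ι) :
    (swap (f (false, i₀)) (f (false, i₁)) * swap (f (true, i₀)) (f (true, i₁))) (f (b, i)) =
      f (b, swap i₀ i₁ i) := by
  cases b <;> simp only [Perm.mul_apply, swap_apply_def] <;> grind [f.injective.eq_iff]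

end Blocks

namespace AltCover

variable {α G : Type*} [Fintype α] [DecidableEq α] [Group G] {π : G →* Equiv.Perm α}

/-- All Klein four-groups give the same commutator. -/
theorem exists_commutator_eq (hπ : AltCover π) (hα : 8 ≤ Fintype.card α) :
    ∃ z, π z = 1 ∧ ∀ a b c d : α, a ≠ b → a ≠ c → a ≠ d → b ≠ c → b ≠ d → c ≠ d → ∀ v w : G,
      π v = Equiv.swap a b * Equiv.swap c d → π w = Equiv.swap a c * Equiv.swap b d →
      ⁅v, w⁆ = z := by
  obtain ⟨s⟩ : Nonempty (Fin 4 ↪ α) :=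
    Function.Embedding.nonempty_of_card_le (by rw [Fintype.card_fin]; omega)
  have hs : ∀ i j, i ≠ j → s i ≠ s j := fun i j h => s.injective.ne h
  obtain ⟨v, hv⟩ := hπ.exists_lift (σ := Equiv.swap (s 0) (s 1) * Equiv.swap (s 2) (s 3))
    (by simp [hs 0 1, hs 2 3])
  obtain ⟨w, hw⟩ := hπ.exists_lift (σ := Equiv.swap (s 0) (s 2) * Equiv.swap (s 1) (s 3))
    (by simp [hs 0 2, hs 1 3])
  have hz : π ⁅v, w⁆ = 1 := by
    rw [map_commutatorElement, commutatorElement_eq_one_iff_commute, hv, hw]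
    ext x
    have := hs 0 1 (by decide)
    have := hs 0 2 (by decide)
    have := hs 0 3 (by decide)
    have := hs 1 2 (by decide)
    have := hs 1 3 (by decide)
    have := hs 2 3 (by decide)
    simp only [Equiv.Perm.mul_apply, Equiv.swap_apply_def]
    grind
  refine ⟨⁅v, w⁆, hz, fun a b c d hab hac had hbc hbd hcd v' w' hv' hw' => ?_⟩
  have h4 : MulAction.IsMultiplyPretransitive (alternatingGroup α) α 4 := by
    have := alternatingGroup.isMultiplyPretransitive α
    refine MulAction.isMultiplyPretransitive_of_le (n := Nat.card α - 2) ?_ (Nat.sub_le _ _)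
    rw [Nat.card_eq_fintype_card]
    omega
  have ht : Function.Injective ![a, b, c, d] := by
    intro i j h
    fin_cases i <;> fin_cases j <;> simp_all
  obtain ⟨τ, hτ⟩ := MulAction.isMultiplyPretransitive_iff.1 h4 s ⟨_, ht⟩
  have hτ' : ∀ i, (τ : Equiv.Perm α) (s i) = ![a, b, c, d] i := fun i =>
    congrArg (fun e : Fin 4 ↪ α => e i) hτ
  obtain ⟨g, hg⟩ := hπ.exists_lift τ.2
  have h1 : ⁅v', w'⁆ = ⁅g * v * g⁻¹, g * w * g⁻¹⁆ := by
    refine hπ.commutator_congr ?_ ?_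
    · rw [map_mul, map_mul, map_inv, hg, hv, conj_swap_mul_swap, hτ', hτ', hτ', hτ', hv']
      rfl
    · rw [map_mul, map_mul, map_inv, hg, hw, conj_swap_mul_swap, hτ', hτ', hτ', hτ', hw']
      rfl
  rw [h1, ← conjugate_commutatorElement, ← hπ.central _ hz, mul_inv_cancel_right]

theorem exists_conj_eq_mul (hπ : AltCover π) {z : G} (hz : π z = 1)
    (hV : ∀ a b c d : α, a ≠ b → a ≠ c → a ≠ d → b ≠ c → b ≠ d → c ≠ d → ∀ v w : G,
      π v = Equiv.swap a b * Equiv.swap c d → π w = Equiv.swap a c * Equiv.swap b d →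
      ⁅v, w⁆ = z) {d m : ℕ} (hd : 6 ≤ d) (hde : Even d) (hm : 2 ≤ m)
    (hα : 2 * d + 5 ≤ Fintype.card α) {s : G} (hs : (π s).cycleType = Multiset.replicate m d) :
    ∃ x, x * s * x⁻¹ = z * s := by
  obtain ⟨k, rfl⟩ : ∃ k, d = k + 1 := ⟨d - 1, by omega⟩
  obtain ⟨f, hf⟩ := exists_embedding_finRotate hm hs
  let δ : Equiv.Perm (Fin (k + 1)) →* Equiv.Perm α :=
    (Equiv.Perm.viaEmbeddingHom f).comp (diagonalPerm (Fin (k + 1)))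
  have hδ : ∀ e b i, δ e (f (b, i)) = f (b, e i) := fun e b i =>
    Equiv.Perm.viaEmbedding_apply _ f (b, i)
  have hδs : ∀ e, Equiv.Perm.sign (δ e) = 1 := fun e =>
    (sign_viaEmbedding _ f).trans (sign_diagonalPerm e)
  have h01 : (⟨0, by omega⟩ : Fin (k + 1)) ≠ ⟨1, by omega⟩ := by simp
  generalize (⟨0, by omega⟩ : Fin (k + 1)) = i₀ at h01
  generalize (⟨1, by omega⟩ : Fin (k + 1)) = i₁ at h01
  obtain ⟨x, hx⟩ := hπ.exists_lift (σ := (flipPerm (Fin (k + 1))).viaEmbedding f)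
    ((sign_viaEmbedding _ f).trans (sign_flipPerm (by rwa [Fintype.card_fin])))
  have hxf : ∀ b i, π x (f (b, i)) = f (!b, i) := fun b i => by
    rw [hx, Equiv.Perm.viaEmbedding_apply]
    cases b <;> rfl
  have hn : ∀ b i b' i', (b, i) ≠ (b', i') → f (b, i) ≠ f (b', i') := fun b i b' i' h =>
    f.injective.ne h
  obtain ⟨p, hp⟩ := hπ.exists_lift (σ := Equiv.swap (f (false, i₀)) (f (true, i₀)) *
    Equiv.swap (f (false, i₁)) (f (true, i₁))) (by
      simp [hn])
  obtain ⟨q, hq⟩ := hπ.exists_lift (σ := Equiv.swap (f (false, i₀)) (f (false, i₁)) *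
    Equiv.swap (f (true, i₀)) (f (true, i₁))) (by
      simp [h01])
  have hpq : p * q * p⁻¹ = z * q := by
    rw [← hV _ _ _ _ (by simp) (by simp [h01]) (by simp) (by simp) (by simp [h01]) (by simp) p q
      hp hq, commutatorElement_def, inv_mul_cancel_right]
  have hxq : x * q * x⁻¹ = z * q := by
    have hc : Commute q (x * p⁻¹) := by
      refine hπ.commute_of_disjoint
        (S := {f (false, i₀), f (false, i₁), f (true, i₀), f (true, i₁)}ᶜ) ?_
        (fun s hs => ?_) (fun s hs => ?_)
      · rw [Finset.card_compl]
        have := Finset.card_le_four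
          (a := f (false, i₀)) (b := f (false, i₁)) (c := f (true, i₀)) (d := f (true, i₁))
        omega
      · simp only [Finset.mem_compl, Finset.mem_insert, Finset.mem_singleton, not_or] at hs
        rw [hq, Equiv.Perm.mul_apply, Equiv.swap_apply_of_ne_of_ne hs.2.2.1 hs.2.2.2,
          Equiv.swap_apply_of_ne_of_ne hs.1 hs.2.1]
      · have hpf : ∀ b i, i = i₀ ∨ i = i₁ → π p (f (b, i)) = f (!b, i) := by
          intro b i hi
          rw [hp]
          cases b <;> rcases hi with rfl | rfl <;>
            simp only [Equiv.Perm.mul_apply, Equiv.swap_apply_def] <;> grind [f.injective.eq_iff]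
        have hgoal : ∀ b i, i = i₀ ∨ i = i₁ → π (x * p⁻¹) (f (b, i)) = f (b, i) := by
          intro b i hi
          rw [map_mul, map_inv, Equiv.Perm.mul_apply,
            Equiv.Perm.inv_eq_iff_eq.2 (show f (b, i) = π p (f (!b, i)) by
              rw [hpf _ _ hi, Bool.not_not]), hxf, Bool.not_not]
        simp only [Finset.mem_compl, not_not, Finset.mem_insert, Finset.mem_singleton] at hs
        rcases hs with rfl | rfl | rfl | rfl <;> apply hgoal <;> simp
    calc x * q * x⁻¹ = x * p⁻¹ * (p * q * p⁻¹) * (x * p⁻¹)⁻¹ := by group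
      _ = x * p⁻¹ * z * q * (x * p⁻¹)⁻¹ := by rw [hpq]; group
      _ = z * (x * p⁻¹ * q) * (x * p⁻¹)⁻¹ := by rw [← hπ.central z hz]; group
      _ = z * q := by rw [← hc.eq]; group
  have hsign : Equiv.Perm.sign (finRotate (k + 1) * Equiv.swap i₀ i₁) = 1 := by
    have hk : Odd k := by
      rw [Nat.even_add_one] at hde
      simpa using hde
    rw [Equiv.Perm.sign_mul, sign_finRotate, Equiv.Perm.sign_swap h01, Nat.add_sub_cancel,
      hk.neg_one_pow]
    rfl
  obtain ⟨e, he⟩ := hπ.exists_lift (hδs (finRotate (k + 1) * Equiv.swap i₀ i₁))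
  have hxe : Commute x e := by
    refine hπ.commute_of_perfect (B := alternatingGroup (Fin (k + 1)))
      (commutator_alternatingGroup_eq_top (by
        rw [Nat.card_eq_fintype_card, Fintype.card_fin]
        omega))
      (δ.comp (alternatingGroup _).subtype) (fun b => hδs b) (fun b => ?_) (b := ⟨_, hsign⟩) he
    rw [hx]
    exact (commute_flipPerm (b : Equiv.Perm (Fin (k + 1)))).map (Equiv.Perm.viaEmbeddingHom f)
  have heq : ∀ b i, π (e * q) (f (b, i)) = f (b, finRotate (k + 1) i) := fun b i => by
    rw [map_mul, Equiv.Perm.mul_apply, hq, swap_mul_swap_apply f h01, he, hδ,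
      Equiv.Perm.mul_apply, Equiv.swap_apply_self]
  have hxr : Commute x ((e * q)⁻¹ * s) := by
    refine hπ.commute_of_disjoint (S := (Finset.univ.map f)ᶜ) ?_ (fun t ht => ?_) (fun t ht => ?_)
    · rw [Finset.card_compl, Finset.card_map, Finset.card_univ, Fintype.card_prod,
        Fintype.card_bool, Fintype.card_fin]
      omega
    · rw [hx]
      refine Equiv.Perm.viaEmbedding_apply_of_notMem _ _ _ ?_
      simpa using ht
    · simp only [Finset.mem_compl, not_not, Finset.mem_map, Finset.mem_univ, true_and] at ht
      obtain ⟨⟨b, i⟩, rfl⟩ := ht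
      rw [map_mul, Equiv.Perm.mul_apply, hf, map_inv, Equiv.Perm.inv_eq_iff_eq, heq]
  refine ⟨x, ?_⟩
  calc x * s * x⁻¹ = x * e * q * ((e * q)⁻¹ * s) * x⁻¹ := by group
    _ = e * (x * q * x⁻¹) * (x * ((e * q)⁻¹ * s)) * x⁻¹ := by rw [hxe.eq]; group
    _ = e * z * q * ((e * q)⁻¹ * s) := by rw [hxq, hxr.eq]; group
    _ = z * s := by rw [← hπ.central z hz e]; group

theorem exists_conj_eq_zpow_mul (hπ : AltCover π) {z s x : G} (hz : π z = 1)
    (hx : x * s * x⁻¹ = z * s) {y : G} (hy : y ∈ Subgroup.zpowers z) :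
    ∃ u, u * s * u⁻¹ = y * s := by
  obtain ⟨i, rfl⟩ := Subgroup.mem_zpowers_iff.1 hy
  have hzc : ∀ g, Commute z g := hπ.central z hz
  have h : s * x * s⁻¹ = z⁻¹ * x := by
    calc s * x * s⁻¹ = z⁻¹ * (z * s) * x * s⁻¹ := by group
      _ = z⁻¹ * x := by rw [← hx]; group
  have hi : s * x ^ i * s⁻¹ = z⁻¹ ^ i * x ^ i := by
    rw [← conj_zpow, h, (hzc x).inv_left.mul_zpow]
  have hi' : s * x ^ i = z⁻¹ ^ i * x ^ i * s := by rw [← hi]; group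
  refine ⟨x ^ i, ?_⟩
  calc x ^ i * s * (x ^ i)⁻¹ = z ^ i * (z⁻¹ ^ i * x ^ i * s) * (x ^ i)⁻¹ := by group
    _ = z ^ i * s := by rw [← hi']; group

/-- The kernel of the cover is generated by the commutator attached to the Klein four-groups. -/
theorem mem_zpowers_of_map_eq_one (hπ : AltCover π) (hα : 8 ≤ Fintype.card α) {z : G}
    (hz : π z = 1)
    (hV : ∀ a b c d : α, a ≠ b → a ≠ c → a ≠ d → b ≠ c → b ≠ d → c ≠ d → ∀ v w : G,
      π v = Equiv.swap a b * Equiv.swap c d → π w = Equiv.swap a c * Equiv.swap b d →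
      ⁅v, w⁆ = z) {y : G} (hy : π y = 1) : y ∈ Subgroup.zpowers z := by
  have hnormal : (Subgroup.zpowers z).Normal := by
    refine ⟨fun n hn g => ?_⟩
    obtain ⟨i, rfl⟩ := Subgroup.mem_zpowers_iff.1 hn
    have hc : Commute z g := hπ.central z hz g
    rwa [← (hc.zpow_left i).eq, mul_inv_cancel_right]
  have hle : Subgroup.zpowers z ≤ π.ker := by
    rw [Subgroup.zpowers_le]
    exact hz
  let ψ : G ⧸ Subgroup.zpowers z →* Equiv.Perm α := QuotientGroup.lift _ π hle
  have hψ : AltCover ψ := by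
    refine ⟨?_, ?_, ?_⟩
    · rw [← hπ.range_eq]
      ext σ
      constructor
      · rintro ⟨⟨g⟩, rfl⟩
        exact ⟨g, rfl⟩
      · rintro ⟨g, rfl⟩
        exact ⟨(g : G ⧸ Subgroup.zpowers z), rfl⟩
    · rintro ⟨u⟩ hu ⟨g⟩
      exact congrArg (QuotientGroup.mk' (Subgroup.zpowers z)) (hπ.central u hu g)
    · rw [commutator_def,
        ← MonoidHom.range_eq_top.2 (QuotientGroup.mk'_surjective (Subgroup.zpowers z)),
        ← map_commutator_eq, hπ.perfect, MonoidHom.range_eq_map]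
  have hVψ : CommutingKleinLifts ψ := by
    intro a b c d hab hac had hbc hbd hcd v w hv hw
    obtain ⟨v, rfl⟩ := QuotientGroup.mk'_surjective _ v
    obtain ⟨w, rfl⟩ := QuotientGroup.mk'_surjective _ w
    rw [← commutatorElement_eq_one_iff_commute]
    have h := hV a b c d hab hac had hbc hbd hcd v w hv hw
    have h' := congrArg (QuotientGroup.mk' (Subgroup.zpowers z)) h
    rw [map_commutatorElement] at h'
    exact h'.trans ((QuotientGroup.eq_one_iff z).2 (Subgroup.mem_zpowers z))
  have h1 : (y : G ⧸ Subgroup.zpowers z) = 1 :=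
    hψ.injective_of_commutingKleinLifts hα hVψ (by
      rw [map_one]
      exact hy)
  exact (QuotientGroup.eq_one_iff y).1 h1

end AltCover

theorem altCover_of_quasisimple {n : ℕ} {G : Type*} [Group G] (hG : commutator G = ⊤)
    (φ : (G ⧸ Subgroup.center G) ≃* alternatingGroup (Fin n)) :
    AltCover ((alternatingGroup (Fin n)).subtype.comp
      (φ.toMonoidHom.comp (QuotientGroup.mk' (Subgroup.center G)))) := by
  refine ⟨?_, fun z hz g => ?_, hG⟩
  · rw [MonoidHom.range_comp, MonoidHom.range_eq_top.2
      (φ.surjective.comp (QuotientGroup.mk'_surjective _)), ← MonoidHom.range_eq_map,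
      Subgroup.range_subtype]
  · have h : φ (z : G ⧸ Subgroup.center G) = 1 := Subtype.ext hz
    rw [map_eq_one_iff φ φ.injective, QuotientGroup.eq_one_iff] at h
    exact (Subgroup.mem_center_iff.1 h g).symm

theorem mul_mem_wordImage {r : ℕ} {w : FreeGroup (Fin r)} {G : Type*} [Group G] {s y : G}
    (hs : s ∈ wordImage w G) (h : ∃ u, u * s * u⁻¹ = y * s) : y * s ∈ wordImage w G := by
  obtain ⟨u, hu⟩ := h
  rw [← hu]
  exact map_mem_wordImage (MulAut.conj u).toMonoidHom hs

theorem stmt3 {dd1 dd2 : ℕ} (w1 : FreeGroup (Fin dd1)) (w2 : FreeGroup (Fin dd2))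
    (I1 I2 J1 J2 : Type) [Group I1] [Group I2] [Group J1] [Group J2]
    [Fintype I1] [Fintype I2] [Fintype J1] [Fintype J2]
    (d e : ℕ) (hd5 : 5 ≤ d) (he5 : 5 ≤ e)
    (hI1 : ∃ y ∈ wordImage w1 I1, orderOf y = d)
    (hI2 : ∃ y ∈ wordImage w2 I2, orderOf y = d)
    (hJ1 : ∃ z ∈ wordImage w1 J1, orderOf z = e)
    (hJ2 : ∃ z ∈ wordImage w2 J2, orderOf z = e)
    (hcop : Nat.Coprime (Fintype.card I1 * Fintype.card I2)
      (Fintype.card J1 * Fintype.card J2))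
    (hdeven : Even d) :
    ∃ N : ℕ, ∀ n : ℕ, N ≤ n → ∀ (G : Type) [Group G] [Fintype G], IsQuasisimple G →
      Nonempty ((G ⧸ Subgroup.center G) ≃* alternatingGroup (Fin n)) →
      ∀ g : G, ∃ a ∈ wordImage w1 G, ∃ b ∈ wordImage w2 G, g = a * b := by
  obtain ⟨y₁, hy₁, ho₁⟩ := hI1
  obtain ⟨y₂, hy₂, ho₂⟩ := hI2
  have hc₁ : 1 ≤ Fintype.card I1 := Fintype.card_pos
  have hc₂ : 1 ≤ Fintype.card I2 := Fintype.card_pos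
  have hd : 6 ≤ d := by
    obtain ⟨r, rfl⟩ := hdeven
    omega
  have hM : 1 ≤ Fintype.card I1 * Fintype.card I2 := Nat.mul_pos hc₁ hc₂
  obtain ⟨N, hN⟩ := exists_eq_mul_of_sign_eq_one (M := 2 * (Fintype.card I1 * Fintype.card I2))
    hd hdeven (by omega)
  refine ⟨max N (2 * d + 8), fun n hn G _ _ hG ⟨φ⟩ g => ?_⟩
  have hNn : N ≤ n := le_trans (le_max_left _ _) hn
  have hdn : 2 * d + 8 ≤ n := le_trans (le_max_right _ _) hn
  have hπ := altCover_of_quasisimple hG.1 φ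
  have hα : 8 ≤ Fintype.card (Fin n) := by
    rw [Fintype.card_fin]
    omega
  let ρ : G →* alternatingGroup (Fin n) :=
    φ.toMonoidHom.comp (QuotientGroup.mk' (Subgroup.center G))
  have hρ : Function.Surjective ρ := φ.surjective.comp (QuotientGroup.mk'_surjective _)
  obtain ⟨a, ha, s, t, hst, hs, ht⟩ := hN n hNn (ρ g) (ρ g).2
  have hm : 2 ≤ 2 * (Fintype.card I1 * Fintype.card I2) * a :=
    le_trans (by omega) (Nat.le_mul_of_pos_right _ ha)
  have hmd : Even (2 * (Fintype.card I1 * Fintype.card I2) * a) :=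
    (even_two_mul _).mul_right _
  have hsign : ∀ u : Equiv.Perm (Fin n),
      u.cycleType = Multiset.replicate (2 * (Fintype.card I1 * Fintype.card I2) * a) d →
      u ∈ alternatingGroup (Fin n) := fun u hu => by
    rw [Equiv.Perm.mem_alternatingGroup, Equiv.Perm.sign_of_cycleType, hu, Multiset.sum_replicate,
      Multiset.card_replicate, smul_eq_mul]
    exact ((hmd.mul_right d).add hmd).neg_one_pow
  obtain ⟨s', hs', hs's⟩ := exists_mem_wordImage_of_surjective hρ
    (mem_wordImage_alternatingGroup hy₁ (by omega) ho₁ (c := Fintype.card I2 * a * d)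
      (σ := ⟨s, hsign s hs⟩) (by ring) hs)
  obtain ⟨t', ht', ht't⟩ := exists_mem_wordImage_of_surjective hρ
    (mem_wordImage_alternatingGroup hy₂ (by omega) ho₂ (c := Fintype.card I1 * a * d)
      (σ := ⟨t, hsign t ht⟩) (by ring) ht)
  obtain ⟨z, hz, hV⟩ := hπ.exists_commutator_eq hα
  obtain ⟨x, hx⟩ := hπ.exists_conj_eq_mul hz hV hd hdeven hm
    (by rw [Fintype.card_fin]; omega) (s := s') (by
      have : (ρ s' : Equiv.Perm (Fin n)) = s := by rw [hs's]
      exact (congrArg Equiv.Perm.cycleType this).trans hs)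
  have hker : ((ρ (g * (s' * t')⁻¹) : alternatingGroup (Fin n)) : Equiv.Perm (Fin n)) = 1 := by
    rw [map_mul, map_inv, map_mul, hs's, ht't]
    simp [hst]
  have hmem := hπ.mem_zpowers_of_map_eq_one hα hz hV (y := g * (s' * t')⁻¹) hker
  exact ⟨_, mul_mem_wordImage hs' (hπ.exists_conj_eq_zpow_mul hz hx hmem), t', ht', by group⟩
end

section
/- For every non-trivial word w, every prime p, and every positive integer l, there exists a finite p-group P such that w(P) contains an element of order p^l. -/
/-- The word `w` takes a value of order `m` in the group `G`. -/
def HasWordValueOfOrder {d : ℕ} (w : FreeGroup (Fin d)) (G : Type*) [Group G] (m : ℕ) : Prop :=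
  ∃ x ∈ wordImage w G, orderOf x = m

section Unipotent

variable {R : Type*} {n : ℕ}

lemma one_add_prime_pow_pow_eq_one [Ring R] {p : ℕ} (hp : p.Prime) {N m : ℕ}
    (hN : ((p ^ N : ℕ) : R) = 0) {x : R} (hx : x ^ p ^ m = 0) :
    (1 + x) ^ p ^ (m + N) = 1 := by
  have h₁ : ((p : ℕ) : Polynomial ℤ) ∣
      (1 + Polynomial.X) ^ p ^ m - (1 + Polynomial.X ^ p ^ m) := by
    obtain ⟨r, hr⟩ :=
      (Commute.all (1 : Polynomial ℤ) Polynomial.X).exists_add_pow_prime_pow_eq hp m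
    refine ⟨1 * Polynomial.X * r, ?_⟩
    rw [hr]
    ring
  obtain ⟨q, hq⟩ := dvd_sub_pow_of_dvd_sub h₁ N
  have h₂ := congrArg (Polynomial.aeval x) hq
  have h₃ : (p : R) ^ (N + 1) = 0 := by
    rw [pow_succ, ← Nat.cast_pow, hN, zero_mul]
  simp only [map_sub, map_pow, map_add, map_one, Polynomial.aeval_X, map_mul, map_natCast,
    hx, h₃, zero_mul, add_zero, one_pow] at h₂
  rw [pow_add, pow_mul]
  exact sub_eq_zero.1 h₂

/-- The monoid of lower triangular matrices with all diagonal entries equal to `1`. -/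
def lowerUnitriangular (n : ℕ) (R : Type*) [Ring R] : Submonoid (Matrix (Fin n) (Fin n) R) where
  carrier := {A | ∀ i j, i ≤ j → (A - 1) i j = 0}
  one_mem' := by simp
  mul_mem' := by
    intro A B hA hB i j hij
    have h : A * B - 1 = (A - 1) * (B - 1) + (A - 1) + (B - 1) := by noncomm_ring
    rw [h, Matrix.add_apply, Matrix.add_apply, hA i j hij, hB i j hij, Matrix.mul_apply,
      Finset.sum_eq_zero, add_zero, add_zero]
    intro k _
    rcases le_total i k with hik | hki
    · rw [hA i k hik, zero_mul]
    · rw [hB k j (hki.trans hij), mul_zero]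

lemma mem_lowerUnitriangular [Ring R] {A : Matrix (Fin n) (Fin n) R} :
    A ∈ lowerUnitriangular n R ↔ ∀ i j, i ≤ j → (A - 1) i j = 0 := Iff.rfl

lemma strictLower_pow_apply [Ring R] {A : Matrix (Fin n) (Fin n) R}
    (hA : ∀ i j, i ≤ j → A i j = 0) (m : ℕ) (i j : Fin n) (h : (i : ℕ) < j + m) :
    (A ^ m) i j = 0 := by
  induction m generalizing i with
  | zero =>
    rw [pow_zero, Matrix.one_apply_ne]
    rintro rfl
    simp at h
  | succ m ih =>
    rw [pow_succ', Matrix.mul_apply, Finset.sum_eq_zero]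
    intro k _
    rcases le_or_gt i k with hik | hki
    · rw [hA i k hik, zero_mul]
    · rw [ih k (by have : (k : ℕ) < i := hki; omega), mul_zero]

lemma exists_pow_eq_one_of_mem_lowerUnitriangular [Ring R] {p : ℕ} (hp : p.Prime) {N : ℕ}
    (hN : ((p ^ N : ℕ) : R) = 0) {A : Matrix (Fin n) (Fin n) R}
    (hA : A ∈ lowerUnitriangular n R) : ∃ k, A ^ p ^ k = 1 := by
  refine ⟨n + N, ?_⟩
  have hpow : (A - 1) ^ p ^ n = 0 := by
    ext i j
    refine strictLower_pow_apply (mem_lowerUnitriangular.1 hA) _ _ _ ?_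
    have := Nat.lt_pow_self (n := n) hp.one_lt
    omega
  have hcast : ((p ^ N : ℕ) : Matrix (Fin n) (Fin n) R) = 0 := by
    rw [← Matrix.diagonal_natCast, hN, Matrix.diagonal_zero]
  simpa using one_add_prime_pow_pow_eq_one hp hcast hpow

end Unipotent

section Transvection

variable {R : Type*} [Ring R]

/-- The one-parameter group `z ↦ 1 + z x` of an element `x` with `x * x = 0`. -/
def oneParameterUnits (x : R) (hx : x * x = 0) : Multiplicative ℤ →* Rˣ :=
  MonoidHom.toHomUnits
    { toFun z := 1 + z.toAdd • x
      map_one' := by simp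
      map_mul' a b := by
        simp only [toAdd_mul, add_smul, mul_add, add_mul, one_mul, mul_one, smul_mul_smul_comm,
          hx, smul_zero, add_zero]
        abel }

@[simp]
lemma coe_oneParameterUnits (x : R) (hx : x * x = 0) (z : Multiplicative ℤ) :
    (oneParameterUnits x hx z : R) = 1 + z.toAdd • x := rfl

end Transvection

section WordMatrix

variable {ι : Type} [DecidableEq ι] (c : ℕ → Option ι) (n : ℕ) (R : Type*) [Ring R]

/-- The matrix sending the basis vector `b` to the basis vector `b + 1` when `c b = i`,
and to zero otherwise. -/
def colourShift (i : ι) : Matrix (Fin n) (Fin n) R :=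
  Matrix.of fun a b => if (a : ℕ) = b + 1 ∧ c b = some i then 1 else 0

lemma colourShift_apply (i : ι) (a b : Fin n) :
    colourShift c n R i a b = if (a : ℕ) = b + 1 ∧ c b = some i then 1 else 0 := rfl

variable {c}

lemma colourShift_mul_self (hc : ∀ b i, c b = some i → c (b + 1) ≠ some i) (i : ι) :
    colourShift c n R i * colourShift c n R i = 0 := by
  ext a b
  rw [Matrix.mul_apply, Matrix.zero_apply, Finset.sum_eq_zero]
  intro k _
  rw [colourShift_apply, colourShift_apply]
  by_cases h : (k : ℕ) = b + 1 ∧ c b = some i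
  · have := hc b i h.2
    rw [← h.1] at this
    simp [this]
  · rw [if_neg h, mul_zero]

/-- The representation of a free product of infinite cyclic groups by unitriangular matrices
attached to a colouring without equal neighbours. -/
def shiftRep (hc : ∀ b i, c b = some i → c (b + 1) ≠ some i) :
    Monoid.CoprodI (fun _ : ι => Multiplicative ℤ) →* (Matrix (Fin n) (Fin n) R)ˣ :=
  Monoid.CoprodI.lift fun i =>
    oneParameterUnits (colourShift c n R i) (colourShift_mul_self n R hc i)

lemma coe_shiftRep_of (hc : ∀ b i, c b = some i → c (b + 1) ≠ some i) (i : ι)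
    (z : Multiplicative ℤ) :
    (shiftRep n R hc (Monoid.CoprodI.of (i := i) z) : Matrix (Fin n) (Fin n) R) =
      1 + z.toAdd • colourShift c n R i := by
  rw [shiftRep, Monoid.CoprodI.lift_of, coe_oneParameterUnits]

lemma shiftRep_mem (hc : ∀ b i, c b = some i → c (b + 1) ≠ some i)
    (w : Monoid.CoprodI (fun _ : ι => Multiplicative ℤ)) :
    (shiftRep n R hc w : Matrix (Fin n) (Fin n) R) ∈ lowerUnitriangular n R := by
  induction w using Monoid.CoprodI.induction_on with
  | one => simp [one_mem]
  | of i z =>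
    rw [coe_shiftRep_of, mem_lowerUnitriangular]
    intro a b hab
    have h : (a : ℕ) ≠ b + 1 := by
      have : (a : ℕ) ≤ b := hab
      omega
    rw [add_sub_cancel_left, Matrix.smul_apply, colourShift_apply, if_neg (fun H => h H.1),
      smul_zero]
  | mul x y hx hy =>
    rw [map_mul, Units.val_mul]
    exact mul_mem hx hy

variable {R n}

lemma shiftRep_prod_apply (hc : ∀ b i, c b = some i → c (b + 1) ≠ some i)
    (L : List (Σ _ : ι, Multiplicative ℤ)) (o : Fin n) (ho : (o : ℕ) = 0)
    (hL : ∀ S x, x :: S <:+ L → c S.length = some x.1) (a : Fin n) (ha : L.length ≤ a) :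
    (shiftRep n R hc (L.map fun l => Monoid.CoprodI.of (i := l.1) l.2).prod :
      Matrix (Fin n) (Fin n) R) a o =
      if (a : ℕ) = L.length then (((L.map fun l => l.2.toAdd).prod : ℤ) : R) else 0 := by
  induction L generalizing a with
  | nil =>
    simp [Matrix.one_apply, Fin.ext_iff, ho]
  | cons x S ih =>
    have hS := ih fun T y h => hL T y (h.trans (List.suffix_cons x S))
    have hcx := hL S x List.suffix_rfl
    rw [List.length_cons] at ha
    rw [List.map_cons, List.prod_cons, map_mul, Units.val_mul, coe_shiftRep_of, add_mul, one_mul,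
      Matrix.add_apply, hS a (by omega), if_neg (by omega), zero_add, smul_mul_assoc,
      Matrix.smul_apply, Matrix.mul_apply]
    obtain ⟨b, hb⟩ : ∃ b : Fin n, (a : ℕ) = b + 1 := ⟨⟨a - 1, by omega⟩, by simp; omega⟩
    rw [Finset.sum_eq_single b]
    · rw [hS b (by omega), colourShift_apply, List.length_cons, hb]
      by_cases h : (b : ℕ) = S.length
      · simp [h, hcx]
      · simp [h]
    · intro k _ hk
      rw [colourShift_apply, if_neg, zero_mul]
      rintro ⟨h, -⟩
      exact hk (Fin.ext (by omega))
    · simp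

end WordMatrix

/-- Free products of infinite cyclic groups are residually finite `p`-groups. -/
lemma exists_hom_pGroup_coprodI {ι : Type} [DecidableEq ι] {p : ℕ} (hp : p.Prime)
    (w : Monoid.CoprodI (fun _ : ι => Multiplicative ℤ)) (hw : w ≠ 1) :
    ∃ (P : Type) (_ : Group P) (_ : Finite P)
      (f : Monoid.CoprodI (fun _ : ι => Multiplicative ℤ) →* P), IsPGroup p P ∧ f w ≠ 1 := by
  classical
  set W := Monoid.CoprodI.Word.equiv w
  have hWw : W.prod = w := Monoid.CoprodI.Word.equiv.symm_apply_apply w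
  set L := W.toList with hL
  have hne : L ≠ [] := by
    intro h
    apply hw
    rw [← hWw, Monoid.CoprodI.Word.prod, ← hL, h]
    simp
  let c : ℕ → Option ι := fun b => (L.reverse[b]?).map Sigma.fst
  have hc : ∀ b i, c b = some i → c (b + 1) ≠ some i := by
    have hchain : L.reverse.IsChain fun l l' => l.1 ≠ l'.1 := by
      rw [List.isChain_reverse]
      exact W.chain_ne.imp fun _ _ h => h.symm
    intro b i h h'
    simp only [c, Option.map_eq_some_iff] at h h'
    obtain ⟨x, hx, rfl⟩ := h
    obtain ⟨y, hy, hxy⟩ := h'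
    rw [List.getElem?_eq_some_iff] at hx hy
    obtain ⟨hx, rfl⟩ := hx
    obtain ⟨hy, rfl⟩ := hy
    exact List.isChain_iff_getElem.1 hchain b hy hxy.symm
  have hcL : ∀ S x, x :: S <:+ L → c S.length = some x.1 := by
    rintro S x ⟨T, hT⟩
    simp [c, ← hT]
  set e : ℤ := (L.map fun l => l.2.toAdd).prod with he
  have he0 : e ≠ 0 := by
    rw [he, Ne, List.prod_eq_zero_iff, List.mem_map]
    rintro ⟨l, hl, h0⟩
    exact W.ne_one l hl h0
  set N := e.natAbs
  have hlt : N < p ^ N := Nat.lt_pow_self hp.one_lt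
  have : NeZero (p ^ N) := ⟨(pow_pos hp.pos _).ne'⟩
  let f := shiftRep (L.length + 1) (ZMod (p ^ N)) hc
  refine ⟨f.range, inferInstance, inferInstance, f.rangeRestrict, ?_, ?_⟩
  · rintro ⟨-, v, rfl⟩
    obtain ⟨k, hk⟩ := exists_pow_eq_one_of_mem_lowerUnitriangular hp
      (ZMod.natCast_self (p ^ N)) (shiftRep_mem (L.length + 1) (ZMod (p ^ N)) hc v)
    refine ⟨k, Subtype.ext (Units.ext ?_)⟩
    simpa using hk
  · intro h
    have h₁ : f w = 1 := congrArg Subtype.val h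
    have h₂ := shiftRep_prod_apply (R := ZMod (p ^ N)) hc L 0 rfl hcL
      (Fin.last L.length) (by simp)
    have h₃ : (L.map fun l => Monoid.CoprodI.of (i := l.1) l.2).prod = w := hWw
    rw [h₃, show shiftRep (L.length + 1) (ZMod (p ^ N)) hc w = 1 from h₁] at h₂
    have h₄ : Fin.last L.length ≠ 0 := by
      simpa [Fin.ext_iff] using hne
    rw [Units.val_one, Matrix.one_apply_ne h₄, if_pos (by simp), ← he, eq_comm,
      ZMod.intCast_zmod_eq_zero_iff_dvd, Int.natCast_dvd] at h₂
    exact absurd (Nat.le_of_dvd (Int.natAbs_pos.2 he0) h₂) (not_le.2 hlt)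

/-- Free groups are residually finite `p`-groups. -/
lemma FreeGroup.exists_hom_pGroup {ι : Type} {p : ℕ} (hp : p.Prime) (w : FreeGroup ι)
    (hw : w ≠ 1) :
    ∃ (P : Type) (_ : Group P) (_ : Finite P) (f : FreeGroup ι →* P), IsPGroup p P ∧ f w ≠ 1 := by
  classical
  let θ : FreeGroup ι →* Monoid.CoprodI (fun _ : ι => Multiplicative ℤ) :=
    FreeGroup.lift fun i => Monoid.CoprodI.of (i := i) (Multiplicative.ofAdd 1)
  let η : Monoid.CoprodI (fun _ : ι => Multiplicative ℤ) →* FreeGroup ι :=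
    Monoid.CoprodI.lift fun i => zpowersHom _ (FreeGroup.of i)
  have hηθ : η.comp θ = MonoidHom.id _ := by
    ext i
    simp [η, θ]
  have hθ : θ w ≠ 1 := by
    intro h
    apply hw
    rw [← MonoidHom.id_apply (M := FreeGroup ι) w, ← hηθ, MonoidHom.comp_apply, h, _root_.map_one]
  obtain ⟨P, _, hfin, f, hP, hf⟩ := exists_hom_pGroup_coprodI hp (θ w) hθ
  exact ⟨P, _, hfin, f.comp θ, hP, hf⟩

/-- If `g ^ p ^ k` survives in some finite `p`-quotient, then `g` has order exactly `p ^ (k + 1)`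
in some finite `p`-quotient. -/
lemma exists_hom_pGroup_orderOf_eq {F : Type*} [Group F] {p : ℕ} (hp : p.Prime) (g : F) (k : ℕ)
    (P : Type) [Group P] [Finite P] (f : F →* P) (hP : IsPGroup p P) (hf : f (g ^ p ^ k) ≠ 1) :
    ∃ (Q : Type) (_ : Group Q) (_ : Finite Q) (f : F →* Q),
      IsPGroup p Q ∧ orderOf (f g) = p ^ (k + 1) := by
  have := Fact.mk hp
  induction hn : Nat.card P using Nat.strong_induction_on generalizing P with
  | _ n ih =>
    subst hn
    have : Nontrivial P := ⟨_, _, hf⟩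
    have := hP.center_nontrivial
    have hZ := hP.to_subgroup (Subgroup.center P)
    obtain ⟨m, hm, hcard⟩ := hZ.nontrivial_iff_card.1 inferInstance
    obtain ⟨z, hz⟩ := exists_prime_orderOf_dvd_card' (G := Subgroup.center P) p
      (hcard ▸ dvd_pow_self p hm.ne')
    rw [← Subgroup.orderOf_coe] at hz
    let Z := Subgroup.zpowers (z : P)
    have hZc : Z ≤ Subgroup.center P := by simp [Z]
    have : Z.Normal := ⟨fun x hx y => by
      rwa [Subgroup.mem_center_iff.1 (hZc hx) y, mul_inv_cancel_right]⟩
    have hcardZ : Nat.card Z = p := by rw [Nat.card_zpowers, hz]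
    by_cases h : f (g ^ p ^ k) ∈ Z
    · refine ⟨P, _, inferInstance, f, hP, orderOf_eq_prime_pow ?_ ?_⟩
      · rwa [← map_pow]
      · rw [pow_succ, pow_mul, ← map_pow]
        have := pow_card_eq_one' (x := (⟨_, h⟩ : Z))
        rw [hcardZ] at this
        exact congrArg Subtype.val this
    · refine ih (Nat.card (P ⧸ Z)) ?_ (P ⧸ Z) ((QuotientGroup.mk' Z).comp f) (hP.to_quotient Z)
        ?_ rfl
      · rw [Subgroup.card_eq_card_quotient_mul_card_subgroup Z, hcardZ]
        exact lt_mul_of_one_lt_right Nat.card_pos hp.one_lt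
      · rwa [MonoidHom.comp_apply, QuotientGroup.mk'_apply, Ne, QuotientGroup.eq_one_iff]

theorem stmt4 {d : ℕ} (w : FreeGroup (Fin d)) (hw : w ≠ 1) (p : ℕ) (hp : p.Prime)
    (l : ℕ) (hl : 0 < l) :
    ∃ (P : Type) (instP : Group P) (_ : Fintype P),
      @IsPGroup p P instP ∧ @HasWordValueOfOrder d w P instP (p ^ l) := by
  obtain ⟨k, rfl⟩ := Nat.exists_eq_add_of_lt hl
  rw [zero_add]
  have hwk : w ^ p ^ k ≠ 1 := by
    rwa [Ne, pow_eq_one_iff_left (pow_pos hp.pos k).ne']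
  obtain ⟨P, _, _, f, hP, hf⟩ := FreeGroup.exists_hom_pGroup hp _ hwk
  obtain ⟨Q, instQ, _, φ, hQ, hφ⟩ := exists_hom_pGroup_orderOf_eq hp w k P f hP hf
  refine ⟨Q, instQ, Fintype.ofFinite Q, hQ, φ w, ⟨fun i => φ (FreeGroup.of i), ?_⟩, hφ⟩
  exact DFunLike.congr_fun (FreeGroup.lift.apply_symm_apply φ) w
end
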